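/- arXiv:gr-qc/0004008 — 2 statements merged into one kernel-verified Lean document; each statement's English description precedes it below -/
import Mathlib

section
/- (Partie finie of the integral of a Laplacian.) Let F ∈ 𝓕 with integer exponents, assume all first and second partial derivatives of F also admit singular expansions at y₁ and y₂, and assume F = o(|x|^{−1}) and ∇F = o(|x|^{−2}) at infinity with ΔF integrable near infinity. Then the Hadamard partie finie Pf_{s₁,s₂} ∫ ΔF d³x exists and equals 4π (r₁ F)₁ + 4π (r₂ F)₂ = ∫_{S²} f_{−1} dΩ + ∫_{S²} g_{−1} dΩ (independently of s₁, s₂). -/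
open MeasureTheory Filter Topology Real Asymptotics

noncomputable section

abbrev E3 : Type := EuclideanSpace ℝ (Fin 3)
abbrev S2 : Type := Metric.sphere (0 : E3) 1

/-- The surface measure `dΩ` on the unit sphere `S²` (total mass `4π`). -/
def dOmega : Measure S2 := (volume : Measure E3).toSphere

/-- A function on the unit sphere is smooth iff it is the restriction of
a smooth function on `ℝ³`. -/
def SmoothSphereFn (f : S2 → ℝ) : Prop :=
  ∃ g : E3 → ℝ, ContDiff ℝ (⊤ : ℕ∞) g ∧ ∀ n : S2, g (n : E3) = f n

/-- `F` admits a power-like singular expansion at `y` with coefficients `c`: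
the family of exponents (the `a`'s with `c a ≠ 0`) is bounded below, with only
finitely many exponents below any given bound, the coefficients are smooth
functions on the sphere, and for every `N`, `F(y + r n) = Σ_{a ≤ N} r^a (c a)(n)
+ o(r^N)` as `r → 0⁺`, uniformly in `n ∈ S²`. -/
structure HasSingExpansion (y : E3) (F : E3 → ℝ) (c : ℝ → S2 → ℝ) : Prop where
  smooth_coeffs : ∀ a : ℝ, SmoothSphereFn (c a)
  bddBelow : ∃ a₀ : ℝ, ∀ a : ℝ, a < a₀ → c a = 0
  finite_exponents : ∀ N : ℝ, {a : ℝ | a ≤ N ∧ c a ≠ 0}.Finite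
  expansion : ∀ N : ℕ, ∀ ε > 0, ∃ δ > 0, ∀ r : ℝ, 0 < r → r < δ → ∀ n : S2,
    |F (y + r • (n : E3)) - ∑ᶠ (a : ℝ) (_ : a ≤ (N : ℝ)), r ^ a * c a n| ≤ ε * r ^ (N : ℝ)

/-- The exponents of the singular expansion are integers. -/
def IntegerExponents (c : ℝ → S2 → ℝ) : Prop :=
  ∀ a : ℝ, c a ≠ 0 → ∃ k : ℤ, a = (k : ℝ)

/-- The Hadamard partie finie at the singular point, `(F)_y = (1/4π) ∫_{S²} f₀ dΩ`,
expressed in terms of the expansion coefficients `c` of `F`. -/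
def pfAt (c : ℝ → S2 → ℝ) : ℝ :=
  (4 * π)⁻¹ * ∫ n : S2, c 0 n ∂dOmega

/-- `F` is smooth on a punctured neighbourhood of `y`. -/
def SmoothNearPunctured (y : E3) (F : E3 → ℝ) : Prop :=
  ∃ U ∈ 𝓝 y, ContDiffOn ℝ (⊤ : ℕ∞) F (U \ {y})

/-- The quantity whose limit as `s → 0⁺` defines the Hadamard partie finie
`Pf_{s₁,s₂} ∫ F d³x`: the integral over `ℝ³` minus two balls of radius `s`,
plus the divergent subtractions built from the expansion coefficients `c` at `y₁`
and `d` at `y₂`. -/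
def pfApprox (y₁ y₂ : E3) (s₁ s₂ : ℝ) (F : E3 → ℝ) (c d : ℝ → S2 → ℝ) (s : ℝ) : ℝ :=
  (∫ x in (Metric.closedBall y₁ s ∪ Metric.closedBall y₂ s)ᶜ, F x)
    + (∑ᶠ (a : ℝ) (_ : a < -3), s ^ (a + 3) / (a + 3) * ∫ n : S2, c a n ∂dOmega)
    + Real.log (s / s₁) * (∫ n : S2, c (-3) n ∂dOmega)
    + (∑ᶠ (b : ℝ) (_ : b < -3), s ^ (b + 3) / (b + 3) * ∫ n : S2, d b n ∂dOmega)
    + Real.log (s / s₂) * (∫ n : S2, d (-3) n ∂dOmega)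

/-- `Pf_{s₁,s₂} ∫ F d³x` exists and equals `L`. -/
def HasPfIntegral (y₁ y₂ : E3) (s₁ s₂ : ℝ) (F : E3 → ℝ) (c d : ℝ → S2 → ℝ) (L : ℝ) : Prop :=
  Tendsto (pfApprox y₁ y₂ s₁ s₂ F c d) (𝓝[>] (0 : ℝ)) (𝓝 L)

/-- Membership in the class `𝓕`: smooth outside `{y₁, y₂}` and admitting singular
expansions at `y₁` (coefficients `c`) and `y₂` (coefficients `d`). -/
structure MemF (y₁ y₂ : E3) (F : E3 → ℝ) (c d : ℝ → S2 → ℝ) : Prop where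
  smooth : ContDiffOn ℝ (⊤ : ℕ∞) F ({y₁, y₂}ᶜ : Set E3)
  exp₁ : HasSingExpansion y₁ F c
  exp₂ : HasSingExpansion y₂ F d

/-- The partial derivative `∂_i F` (as a plain function, defined outside the
singularities via `fderiv`). -/
def pder (i : Fin 3) (F : E3 → ℝ) (x : E3) : ℝ :=
  fderiv ℝ F x (EuclideanSpace.single i 1)


lemma pf_polar (y : E3) (f : E3 → ℝ) (hf : Integrable f) :
    ∫ x, f x = ∫ r in Set.Ioi (0:ℝ), r ^ 2 * ∫ n : S2, f (y + r • (n : E3)) ∂dOmega := by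
  have hfy : Integrable (fun x => f (y + x)) := hf.comp_add_left y
  have e0 : ∫ x, f x = ∫ x, f (y + x) := (integral_add_left_eq_self f y).symm
  have hdim : Module.finrank ℝ E3 - 1 = 2 := by simp
  have hmp := (volume : Measure E3).measurePreserving_homeomorphUnitSphereProd
  rw [hdim] at hmp
  set g : S2 × Set.Ioi (0:ℝ) → ℝ := fun p => f (y + (p.2 : ℝ) • (p.1 : E3)) with hg
  have hgc : ∀ x : ({0}ᶜ : Set E3), g (homeomorphUnitSphereProd E3 x) = f (y + x) := by
    intro x
    have : ((homeomorphUnitSphereProd E3).symm (homeomorphUnitSphereProd E3 x) : E3) = x := by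
      simp
    rw [homeomorphUnitSphereProd_symm_apply_coe] at this
    simp only [hg]
    rw [this]
  have e1 : ∫ x, f (y + x) = ∫ x : ({0}ᶜ : Set E3), f (y + x) ∂((volume : Measure E3).comap (↑)) := by
    rw [integral_subtype_comap (measurableSet_singleton _).compl fun x ↦ f (y + x),
        restrict_compl_singleton]
  have e2 : ∫ x : ({0}ᶜ : Set E3), f (y + x) ∂((volume : Measure E3).comap (↑)) =
      ∫ p, g p ∂(dOmega.prod (Measure.volumeIoiPow 2)) := by
    have := hmp.integral_comp (Homeomorph.measurableEmbedding _) g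
    simp only [hgc] at this
    exact this
  have hgi : Integrable g (dOmega.prod (Measure.volumeIoiPow 2)) := by
    have := hmp.integrable_comp_emb (g := g) (Homeomorph.measurableEmbedding _)
    refine this.1 ?_
    have h2 : (g ∘ (homeomorphUnitSphereProd E3)) = (fun x => f (y + x)) ∘ Subtype.val := by
      funext x; exact hgc x
    rw [h2, ← integrableOn_iff_comap_subtypeVal (measurableSet_singleton _).compl, IntegrableOn,
      restrict_compl_singleton]
    exact hfy
  have : IsFiniteMeasure dOmega := by unfold dOmega; infer_instance
  rw [e0, e1, e2, integral_prod_symm g hgi]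
  simp only [Measure.volumeIoiPow, ENNReal.ofReal]
  rw [integral_withDensity_eq_integral_smul,
    integral_subtype_comap measurableSet_Ioi fun a ↦ Real.toNNReal (a ^ 2) •
      ∫ n : S2, f (y + a • (n : E3)) ∂dOmega,
        setIntegral_congr_fun measurableSet_Ioi fun x hx ↦ ?_]
  · rw [NNReal.smul_def, Real.coe_toNNReal _ (pow_nonneg (Set.mem_Ioi.1 hx).le _), smul_eq_mul]
  · exact (measurable_subtype_coe.pow_const _).real_toNNReal

/-- the model functions `r ^ a * (log r) ^ j` -/
def pfMono (p : ℝ × ℕ) (r : ℝ) : ℝ := r ^ p.1 * Real.log r ^ p.2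

lemma pf_rpow_log_tendsto (a : ℝ) (ha : 0 < a) (k : ℕ) :
    Tendsto (fun r : ℝ => r ^ a * |Real.log r| ^ k) (𝓝[>] 0) (𝓝 0) := by
  rcases Nat.eq_zero_or_pos k with rfl | hk
  · simp only [pow_zero, mul_one]
    have := (Real.continuousAt_rpow_const 0 a (Or.inr ha.le)).tendsto
    rw [Real.zero_rpow ha.ne'] at this
    exact this.mono_left nhdsWithin_le_nhds
  · have hk' : (0:ℝ) < k := by exact_mod_cast hk
    have h := (tendsto_log_mul_rpow_nhdsGT_zero (r := a / k) (by positivity)).abs.pow k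
    simp only [abs_zero, zero_pow hk.ne'] at h
    refine h.congr' ?_
    filter_upwards [self_mem_nhdsWithin] with r hr
    have hr : 0 < r := hr
    rw [abs_mul, mul_pow, mul_comm, abs_of_pos (Real.rpow_pos_of_pos hr _), ← Real.rpow_natCast,
      ← Real.rpow_mul hr.le]
    congr 2
    field_simp

lemma pf_mono_dom (p q : ℝ × ℕ) (h : toLex (-q.1, q.2) < toLex (-p.1, p.2)) :
    Tendsto (fun r => pfMono q r / pfMono p r) (𝓝[>] 0) (𝓝 0) := by
  have hlog : ∀ᶠ r : ℝ in 𝓝[>] 0, Real.log r < -1 :=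
    Real.tendsto_log_nhdsGT_zero.eventually (eventually_lt_atBot (-1))
  rw [Prod.Lex.toLex_lt_toLex] at h
  simp only at h
  rcases h with h | ⟨h1, h2⟩
  · have := pf_rpow_log_tendsto (q.1 - p.1) (by linarith) q.2
    refine squeeze_zero_norm' ?_ this
    filter_upwards [hlog, self_mem_nhdsWithin] with r hl hr
    have hr : 0 < r := hr
    unfold pfMono
    rw [Real.norm_eq_abs, abs_div, abs_mul, abs_mul, abs_pow, abs_pow,
      abs_of_pos (Real.rpow_pos_of_pos hr _), abs_of_pos (Real.rpow_pos_of_pos hr _),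
      Real.rpow_sub hr]
    have hp := Real.rpow_pos_of_pos hr p.1
    have hq := Real.rpow_pos_of_pos hr q.1
    have h1 : 1 ≤ |Real.log r| ^ p.2 := by
      apply one_le_pow₀
      rw [abs_of_neg (by linarith)]; linarith
    calc _ ≤ r ^ q.1 * |Real.log r| ^ q.2 / (r ^ p.1 * 1) := by gcongr
      _ = _ := by field_simp
  · have h1 : q.1 = p.1 := by linarith
    have ht : Tendsto (fun r => (Real.log r)⁻¹) (𝓝[>] 0) (𝓝 0) :=
      tendsto_inv_atBot_zero.comp Real.tendsto_log_nhdsGT_zero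
    have := ht.pow (p.2 - q.2)
    rw [zero_pow (by omega)] at this
    refine this.congr' ?_
    filter_upwards [hlog, self_mem_nhdsWithin] with r hl hr
    have hr : 0 < r := hr
    have hp := Real.rpow_pos_of_pos hr p.1
    have hl0 : Real.log r ≠ 0 := by linarith
    unfold pfMono
    rw [h1, inv_pow]
    obtain ⟨k, hk⟩ : ∃ k, p.2 = q.2 + k := ⟨p.2 - q.2, by omega⟩
    rw [hk, show q.2 + k - q.2 = k by omega, pow_add]
    field_simp

lemma pf_indep (b : (ℝ × ℕ) →₀ ℝ)
    (hb : Tendsto (fun r => b.sum fun p x => x * pfMono p r) (𝓝[>] 0) (𝓝 0))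
    (p : ℝ × ℕ) (hp : p.1 ≤ 0) : b p = 0 := by
  by_contra hne
  have hmem : p ∈ b.support := Finsupp.mem_support_iff.2 hne
  obtain ⟨m, hm, hmax⟩ := b.support.exists_max_image (fun q => toLex (-q.1, q.2)) ⟨p, hmem⟩
  have hm0 : m.1 ≤ 0 := by
    have := hmax p hmem
    rw [Prod.Lex.toLex_le_toLex] at this
    simp only at this
    rcases this with h | ⟨h, _⟩ <;> linarith
  have hlog : ∀ᶠ r : ℝ in 𝓝[>] 0, Real.log r < -1 :=
    Real.tendsto_log_nhdsGT_zero.eventually (eventually_lt_atBot (-1))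
  have hlt1 : ∀ᶠ r : ℝ in 𝓝[>] 0, r < 1 :=
    (eventually_lt_nhds zero_lt_one).filter_mono nhdsWithin_le_nhds
  have hbig : ∀ᶠ r : ℝ in 𝓝[>] 0, 1 ≤ |pfMono m r| := by
    filter_upwards [hlog, hlt1, self_mem_nhdsWithin] with r hl h1 hr
    have hr : 0 < r := hr
    unfold pfMono
    rw [abs_mul, abs_pow, abs_of_pos (Real.rpow_pos_of_pos hr _)]
    have h1 : 1 ≤ |Real.log r| ^ m.2 := by
      apply one_le_pow₀
      rw [abs_of_neg (by linarith)]; linarith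
    have h2 : 1 ≤ r ^ m.1 := Real.one_le_rpow_of_pos_of_le_one_of_nonpos hr (by linarith) hm0
    nlinarith
  have t1 : Tendsto (fun r => (b.sum fun p x => x * pfMono p r) / pfMono m r) (𝓝[>] 0) (𝓝 0) := by
    refine squeeze_zero_norm' ?_ (by simpa using hb.norm)
    filter_upwards [hbig] with r hr
    rw [norm_div]
    apply div_le_self (norm_nonneg _) hr
  have t2 : Tendsto (fun r => (b.sum fun p x => x * pfMono p r) / pfMono m r) (𝓝[>] 0)
      (𝓝 (b.sum fun q x => if q = m then x else 0)) := by
    simp only [Finsupp.sum, Finset.sum_div]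
    refine tendsto_finsetSum _ fun q hq => ?_
    split_ifs with h
    · subst h
      refine tendsto_const_nhds.congr' ?_
      filter_upwards [hbig] with r hr
      have : pfMono q r ≠ 0 := by
        intro h0; rw [h0] at hr; simp at hr; linarith
      field_simp
    · have hlt : toLex (-q.1, q.2) < toLex (-m.1, m.2) := by
        refine lt_of_le_of_ne (hmax q hq) ?_
        intro he
        apply h
        have := toLex.injective he
        simp only [Prod.mk.injEq, neg_inj] at this
        exact Prod.ext this.1 this.2
      have := (pf_mono_dom m q hlt).const_mul (b q)
      simpa [mul_div_assoc] using this
  have := tendsto_nhds_unique t1 t2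
  simp only [Finsupp.sum, Finset.sum_ite_eq', hm, if_true] at this
  exact (Finsupp.mem_support_iff.1 hm) this.symm

lemma pf_lim (E E' : ℝ → ℝ) (δ : ℝ) (hδ : 0 < δ) (k : ℕ)
    (hE : ∀ r, 0 < r → r < δ → HasDerivAt E (E' r) r)
    (hb : ∀ r, 0 < r → r < δ → |E' r| ≤ r ^ k) :
    ∃ C, ∀ r, 0 < r → r < δ → |E r - C| ≤ r ^ (k + 1) := by
  have key : ∀ t r, 0 < t → t ≤ r → r < δ → |E r - E t| ≤ r ^ (k + 1) := by
    intro t r ht htr hr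
    have := (convex_Icc t r).norm_image_sub_le_of_norm_hasDerivWithin_le (f := E) (f' := E')
      (C := r ^ k)
      (fun x hx => (hE x (ht.trans_le hx.1) (hx.2.trans_lt hr)).hasDerivWithinAt)
      (fun x hx => (hb x (ht.trans_le hx.1) (hx.2.trans_lt hr)).trans
        (pow_le_pow_left₀ (ht.le.trans hx.1) hx.2 k))
      (Set.left_mem_Icc.2 htr) (Set.right_mem_Icc.2 htr)
    rw [Real.norm_eq_abs, Real.norm_eq_abs, abs_of_nonneg (sub_nonneg.2 htr)] at this
    refine this.trans ?_
    rw [pow_succ]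
    have : 0 ≤ r ^ k := pow_nonneg (ht.le.trans htr) k
    nlinarith
  have hcau : Cauchy (map E (𝓝[>] 0)) := by
    rw [Metric.cauchy_iff]
    refine ⟨inferInstance, fun ε hε => ?_⟩
    have ht : Tendsto (fun r : ℝ => r ^ (k + 1)) (𝓝[>] 0) (𝓝 0) := by
      have : Tendsto (fun r : ℝ => r ^ (k + 1)) (𝓝 0) (𝓝 (0 ^ (k + 1))) :=
        (continuous_pow (k + 1)).tendsto 0
      simp only [ne_eq, Nat.add_eq_zero_iff, one_ne_zero, and_false, not_false_eq_true,
        zero_pow] at this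
      exact this.mono_left nhdsWithin_le_nhds
    have h1 : ∀ᶠ r : ℝ in 𝓝[>] 0, r ^ (k + 1) < ε := ht.eventually (eventually_lt_nhds hε)
    have h2 : ∀ᶠ r : ℝ in 𝓝[>] 0, r < δ :=
      (eventually_lt_nhds hδ).filter_mono nhdsWithin_le_nhds
    refine ⟨E '' {r | r ^ (k + 1) < ε ∧ r < δ ∧ 0 < r}, ?_, ?_⟩
    · apply image_mem_map
      filter_upwards [h1, h2, self_mem_nhdsWithin] with r a b c using ⟨a, b, c⟩
    · rintro _ ⟨x, ⟨hx1, hx2, hx3⟩, rfl⟩ _ ⟨z, ⟨hz1, hz2, hz3⟩, rfl⟩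
      rw [Real.dist_eq]
      rcases le_total x z with h | h
      · rw [abs_sub_comm]; exact (key x z hx3 h hz2).trans_lt hz1
      · exact (key z x hz3 h hx2).trans_lt hx1
  obtain ⟨C, hC⟩ := CompleteSpace.complete hcau
  refine ⟨C, fun r hr hrδ => ?_⟩
  have hC' : Tendsto E (𝓝[>] 0) (𝓝 C) := hC
  have h3 : Tendsto (fun t => |E r - E t|) (𝓝[>] 0) (𝓝 |E r - C|) :=
    (tendsto_const_nhds.sub hC').abs
  refine le_of_tendsto h3 ?_
  have h2 : ∀ᶠ t : ℝ in 𝓝[>] 0, t < r :=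
      (eventually_lt_nhds hr).filter_mono nhdsWithin_le_nhds
  filter_upwards [h2, self_mem_nhdsWithin] with t ht1 ht2
  exact key t r ht2 ht1.le hrδ

lemma pf_rpow_hasDeriv (a b : ℝ) (hab : a = b - 1) (hb : b ≠ 0) (r : ℝ) (hr : 0 < r) :
    HasDerivAt (fun r : ℝ => r ^ b / b) (r ^ a) r := by
  have := (Real.hasDerivAt_rpow_const (p := b) (Or.inl hr.ne')).div_const b
  subst hab
  refine this.congr_deriv ?_
  rw [mul_comm, mul_div_assoc, div_self hb, mul_one]

lemma pf_of_bound (E : ℝ → ℝ) (C δ : ℝ) (hδ : 0 < δ) (k : ℕ)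
    (h : ∀ r, 0 < r → r < δ → |E r - C| ≤ r ^ (k + 1)) : Tendsto E (𝓝[>] 0) (𝓝 C) := by
  rw [tendsto_iff_norm_sub_tendsto_zero]
  have ht : Tendsto (fun r : ℝ => r ^ (k + 1)) (𝓝[>] 0) (𝓝 0) := by
    have : Tendsto (fun r : ℝ => r ^ (k + 1)) (𝓝 0) (𝓝 (0 ^ (k + 1))) :=
      (continuous_pow (k + 1)).tendsto 0
    simp only [ne_eq, Nat.add_eq_zero_iff, one_ne_zero, and_false, not_false_eq_true,
      zero_pow] at this
    exact this.mono_left nhdsWithin_le_nhds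
  refine squeeze_zero' (Eventually.of_forall fun _ => norm_nonneg _) ?_ ht
  have h2 : ∀ᶠ t : ℝ in 𝓝[>] 0, t < δ :=
      (eventually_lt_nhds hδ).filter_mono nhdsWithin_le_nhds
  filter_upwards [h2, self_mem_nhdsWithin] with t ht1 ht2
  exact h t ht2 ht1

lemma pf_sum_split (T : Finset ℝ) (lc : ℝ → ℝ) (x : ℝ) (hT : x ∉ T → lc x = 0) (f : ℝ → ℝ) :
    ∑ a ∈ T, lc a * f a = ∑ a ∈ T.erase x, lc a * f a + lc x * f x := by
  by_cases h : x ∈ T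
  · rw [Finset.sum_erase_add _ _ h]
  · rw [Finset.erase_eq_of_notMem h, hT h]; simp

lemma pf_radial (ρ : ℝ) (hρ : 0 < ρ) (m H L : ℝ → ℝ)
    (hm : ∀ r, 0 < r → r < ρ → HasDerivAt m (H r / r ^ 2) r)
    (hH : ∀ r, 0 < r → r < ρ → HasDerivAt H (r ^ 2 * L r) r)
    (S T : Finset ℝ) (mc lc : ℝ → ℝ)
    (hS : ∀ a, a ≤ 0 → a ∉ S → mc a = 0) (hT : ∀ a, a ≤ 0 → a ∉ T → lc a = 0)
    (hme : Tendsto (fun r => m r - ∑ a ∈ S, mc a * r ^ a) (𝓝[>] 0) (𝓝 0))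
    (hLe : Tendsto (fun r => L r - ∑ a ∈ T, lc a * r ^ a) (𝓝[>] 0) (𝓝 0))
    (s₁ : ℝ) :
    Tendsto (fun s => -H s + (∑ a ∈ T with a < -3, s ^ (a + 3) / (a + 3) * lc a)
      + Real.log (s / s₁) * lc (-3)) (𝓝[>] 0) (𝓝 (mc (-1))) := by
  set T1 := T.erase (-3) with hT1
  set T2 := T1.erase (-2) with hT2
  obtain ⟨δ, hδ, hδρ, hδL⟩ : ∃ δ, 0 < δ ∧ δ ≤ ρ ∧ ∀ r, 0 < r → r < δ →
      |L r - ∑ a ∈ T, lc a * r ^ a| ≤ 1 := by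
    have h1 : ∀ᶠ r in 𝓝[>] (0:ℝ), |L r - ∑ a ∈ T, lc a * r ^ a| < 1 := by
      have := hLe.abs
      rw [abs_zero] at this
      exact this.eventually (eventually_lt_nhds zero_lt_one)
    rw [eventually_nhdsWithin_iff, Metric.eventually_nhds_iff] at h1
    obtain ⟨ε, hε, h⟩ := h1
    refine ⟨min ε ρ, lt_min hε hρ, min_le_right _ _, fun r h0 hr => ?_⟩
    refine (h ?_ h0).le
    rw [Real.dist_eq, sub_zero, abs_of_pos h0]
    exact hr.trans_le (min_le_left _ _)
  set E : ℝ → ℝ := fun r => H r - ∑ a ∈ T1, lc a * (r ^ (a + 3) / (a + 3))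
    - lc (-3) * Real.log r with hE
  have hE' : ∀ r, 0 < r → r < δ → HasDerivAt E (r ^ 2 * (L r - ∑ a ∈ T, lc a * r ^ a)) r := by
    intro r h0 hr
    have d1 : HasDerivAt (fun r : ℝ => ∑ a ∈ T1, lc a * (r ^ (a + 3) / (a + 3)))
        (∑ a ∈ T1, lc a * r ^ (a + 2)) r := by
      refine HasDerivAt.fun_sum fun a ha => ?_
      refine (pf_rpow_hasDeriv (a + 2) (a + 3) (by ring) ?_ r h0).const_mul _
      intro h
      exact (Finset.ne_of_mem_erase ha) (by linarith)
    have d2 := ((hH r h0 (hr.trans_le hδρ)).sub d1).sub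
      ((Real.hasDerivAt_log h0.ne').const_mul (lc (-3)))
    refine d2.congr_deriv ?_
    rw [pf_sum_split T lc (-3) (hT _ (by norm_num)) (fun a => r ^ a), mul_sub, mul_add,
      Finset.mul_sum]
    have e1 : ∀ a, lc a * r ^ (a + 2) = r ^ 2 * (lc a * r ^ a) := by
      intro a
      rw [Real.rpow_add h0, Real.rpow_two]; ring
    simp only [e1]
    have e2 : r ^ (-3 : ℝ) = (r ^ 3)⁻¹ := by
      rw [Real.rpow_neg h0.le]; norm_cast
    rw [e2]
    field_simp
    ring
  obtain ⟨C, hC⟩ := pf_lim E _ δ hδ 2 hE' (by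
    intro r h0 hr
    rw [abs_mul, abs_of_pos (by positivity)]
    have := hδL r h0 hr
    have h2 : 0 < r ^ 2 := by positivity
    nlinarith)
  set Q : ℝ → ℝ := fun r => m r - ∑ a ∈ T2, lc a / (a + 3) * (r ^ (a + 2) / (a + 2))
    - lc (-2) * Real.log r + lc (-3) * ((Real.log r + 1) * r⁻¹) + C * r⁻¹ with hQ
  have hQ' : ∀ r, 0 < r → r < δ → HasDerivAt Q ((E r - C) / r ^ 2) r := by
    intro r h0 hr
    have d1 : HasDerivAt (fun r : ℝ => ∑ a ∈ T2, lc a / (a + 3) * (r ^ (a + 2) / (a + 2)))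
        (∑ a ∈ T2, lc a / (a + 3) * r ^ (a + 1)) r := by
      refine HasDerivAt.fun_sum fun a ha => ?_
      refine (pf_rpow_hasDeriv (a + 1) (a + 2) (by ring) ?_ r h0).const_mul _
      intro h
      exact (Finset.ne_of_mem_erase ha) (by linarith)
    have dl := Real.hasDerivAt_log h0.ne'
    have di := hasDerivAt_inv h0.ne'
    have d2 := ((((hm r h0 (hr.trans_le hδρ)).sub d1).sub
      (dl.const_mul (lc (-2)))).add (((dl.add_const 1).mul di).const_mul (lc (-3)))).add
        (di.const_mul C)
    refine d2.congr_deriv ?_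
    simp only [hE]
    have hT1' : -2 ∉ T1 → lc (-2) = 0 := by
      intro h
      apply hT _ (by norm_num)
      intro h'
      exact h (Finset.mem_erase.2 ⟨by norm_num, h'⟩)
    rw [pf_sum_split T1 lc (-2) hT1' (fun a => r ^ (a + 3) / (a + 3))]
    have e1 : ∀ a, lc a / (a + 3) * r ^ (a + 1) = (lc a * (r ^ (a + 3) / (a + 3))) / r ^ 2 := by
      intro a
      have : r ^ (a + 3) = r ^ (a + 1) * r ^ 2 := by
        rw [← Real.rpow_two, ← Real.rpow_add h0]; congr 1; ring
      rw [this]; field_simp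
    simp only [e1]
    rw [← Finset.sum_div]
    have e2 : r ^ (-2 + 3 : ℝ) = r := by norm_num
    rw [e2]
    field_simp
    ring
  obtain ⟨C', hC'⟩ := pf_lim Q _ δ hδ 1 hQ' (by
    intro r h0 hr
    rw [abs_div, abs_of_pos (by positivity : 0 < r ^ 2), div_le_iff₀ (by positivity)]
    have := hC r h0 hr
    calc _ ≤ _ := this
      _ = _ := by ring)
  have hEt := pf_of_bound E C δ hδ 2 hC
  have hQt := pf_of_bound Q C' δ hδ 1 hC'
  set b : (ℝ × ℕ) →₀ ℝ := (∑ a ∈ S, Finsupp.single (a, 0) (mc a))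
    - (∑ a ∈ T2, Finsupp.single (a + 2, 0) (lc a / (a + 3) / (a + 2)))
    - Finsupp.single (0, 1) (lc (-2)) + Finsupp.single (-1, 1) (lc (-3))
    + Finsupp.single (-1, 0) (lc (-3) + C) - Finsupp.single (0, 0) C' with hbdef
  have hbsum : ∀ r : ℝ, 0 < r → (b.sum fun p x => x * pfMono p r) =
      (Q r - C') - (m r - ∑ a ∈ S, mc a * r ^ a) := by
    intro r h0
    have : (b.sum fun p x => x * pfMono p r) =
      Finsupp.linearCombination ℝ (fun p => pfMono p r) b := by
      rw [Finsupp.linearCombination_apply]; rfl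
    rw [this, hbdef]
    simp only [map_add, map_sub, map_sum, Finsupp.linearCombination_single, smul_eq_mul, hQ,
      pfMono, pow_zero, pow_one, mul_one, Real.rpow_zero, one_mul, Real.rpow_neg_one]
    have e3 : ∀ a, lc a / (a + 3) / (a + 2) * r ^ (a + 2) =
      lc a / (a + 3) * (r ^ (a + 2) / (a + 2)) := by intro a; ring
    simp only [e3]
    ring
  have hbt : Tendsto (fun r => b.sum fun p x => x * pfMono p r) (𝓝[>] 0) (𝓝 0) := by
    have h1 : Tendsto (fun r => (Q r - C') - (m r - ∑ a ∈ S, mc a * r ^ a)) (𝓝[>] 0)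
        (𝓝 ((C' - C') - 0)) := (hQt.sub_const C').sub hme
    rw [sub_self, sub_zero] at h1
    refine h1.congr' ?_
    filter_upwards [self_mem_nhdsWithin] with r hr
    exact (hbsum r hr).symm
  have hind := pf_indep b hbt
  have hl3 : lc (-3) = 0 := by
    have := hind (-1, 1) (by norm_num)
    simpa [hbdef, Finsupp.finsetSum_apply, Finsupp.single_apply] using this
  have hmC : mc (-1) = -C := by
    have := hind (-1, 0) (by norm_num)
    have z : ∑ a ∈ T2, (Finsupp.single (a + 2, 0) (lc a / (a + 3) / (a + 2)) : (ℝ × ℕ) →₀ ℝ) (-1, 0)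
        = 0 := by
      refine Finset.sum_eq_zero fun a ha => ?_
      rw [Finsupp.single_apply, if_neg]
      intro h
      simp only [Prod.mk.injEq, and_true] at h
      have : a = -3 := by linarith
      exact (Finset.ne_of_mem_erase (Finset.mem_of_mem_erase ha)) this
    have z2 : ∑ a ∈ S, (Finsupp.single (a, 0) (mc a) : (ℝ × ℕ) →₀ ℝ) (-1, 0) = mc (-1) := by
      simp only [Finsupp.single_apply, Prod.mk.injEq, and_true, Finset.sum_ite_eq']
      split_ifs with h
      · rfl
      · exact (hS _ (by norm_num) h).symm
    rw [hbdef] at this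
    simp only [Finsupp.sub_apply, Finsupp.add_apply, Finsupp.finsetSum_apply] at this
    rw [z, z2] at this
    simp [hl3] at this
    linarith
  rw [hmC, hl3]
  have hrest : Tendsto (fun s : ℝ => ∑ a ∈ T1 with ¬ a < -3, lc a * (s ^ (a + 3) / (a + 3)))
      (𝓝[>] 0) (𝓝 0) := by
    rw [← Finset.sum_const_zero (s := {a ∈ T1 | ¬ a < -3})]
    refine tendsto_finsetSum _ fun a ha => ?_
    rw [Finset.mem_filter] at ha
    have hpos : 0 < a + 3 := by
      have h1 := Finset.ne_of_mem_erase ha.1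
      have h2 := lt_of_le_of_ne (not_lt.1 ha.2) h1.symm
      linarith
    have := ((pf_rpow_log_tendsto (a + 3) hpos 0).div_const (a + 3)).const_mul (lc a)
    simpa using this
  have := hEt.neg.sub hrest
  rw [sub_zero] at this
  refine this.congr fun s => ?_
  have e5 : ∑ a ∈ T with a < -3, s ^ (a + 3) / (a + 3) * lc a =
      ∑ a ∈ T1 with a < -3, lc a * (s ^ (a + 3) / (a + 3)) := by
    have : {a ∈ T | a < -3} = {a ∈ T1 | a < -3} := by
      ext a
      simp only [hT1, Finset.mem_filter, Finset.mem_erase]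
      constructor
      · rintro ⟨h1, h2⟩; exact ⟨⟨h2.ne, h1⟩, h2⟩
      · rintro ⟨⟨_, h1⟩, h2⟩; exact ⟨h1, h2⟩
    rw [this]
    exact Finset.sum_congr rfl fun a _ => mul_comm _ _
  simp only [hE]
  rw [e5, hl3, ← Finset.sum_filter_add_sum_filter_not T1 (fun a => a < -3)]
  ring

instance pf_finite_dOmega : IsFiniteMeasure dOmega := by unfold dOmega; infer_instance

lemma pf_smooth_sphere_integrable (f : S2 → ℝ) (hf : Continuous f) : Integrable f dOmega :=
  hf.integrable_of_hasCompactSupport (HasCompactSupport.of_compactSpace f)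

lemma SmoothSphereFn.pf_continuous {f : S2 → ℝ} (hf : SmoothSphereFn f) : Continuous f := by
  obtain ⟨g, hg, h⟩ := hf
  have : f = fun n : S2 => g n := by funext n; exact (h n).symm
  rw [this]
  exact hg.continuous.comp continuous_subtype_val

lemma pf_exp_mean (y : E3) (F : E3 → ℝ) (c : ℝ → S2 → ℝ) (h : HasSingExpansion y F c)
    (hcont : ∀ᶠ r in 𝓝[>] (0:ℝ), Continuous (fun n : S2 => F (y + r • (n : E3)))) :
    Tendsto (fun r : ℝ => (∫ n : S2, F (y + r • (n : E3)) ∂dOmega)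
      - ∑ a ∈ (h.finite_exponents 0).toFinset, (∫ n : S2, c a n ∂dOmega) * r ^ a)
      (𝓝[>] 0) (𝓝 0) := by
  set S := (h.finite_exponents 0).toFinset with hS
  set A := dOmega.real Set.univ with hA
  have hA0 : 0 ≤ A := measureReal_nonneg
  rw [Metric.tendsto_nhds]
  intro ε hε
  obtain ⟨δ, hδ, hb⟩ := h.expansion 0 (ε / (A + 1)) (by positivity)
  have h2 : ∀ᶠ t : ℝ in 𝓝[>] 0, t < δ :=
      (eventually_lt_nhds hδ).filter_mono nhdsWithin_le_nhds
  filter_upwards [h2, self_mem_nhdsWithin, hcont] with r hr h0 hc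
  have h0 : 0 < r := h0
  have hfin : ∀ n : S2, ∑ᶠ (a : ℝ) (_ : a ≤ ((0:ℕ) : ℝ)), r ^ a * c a n =
      ∑ a ∈ S, r ^ a * c a n := by
    intro n
    apply finsum_cond_eq_sum_of_cond_iff
    intro a ha
    have : c a ≠ 0 := by
      intro h0; rw [h0] at ha; simp at ha
    simp [hS, this]
  have hci : ∀ a, Integrable (c a) dOmega :=
    fun a => pf_smooth_sphere_integrable _ (h.smooth_coeffs a).pf_continuous
  have e1 : (∫ n : S2, F (y + r • (n : E3)) ∂dOmega)
      - ∑ a ∈ S, (∫ n : S2, c a n ∂dOmega) * r ^ a =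
      ∫ n : S2, (F (y + r • (n : E3)) - ∑ a ∈ S, r ^ a * c a n) ∂dOmega := by
    rw [integral_sub (pf_smooth_sphere_integrable _ hc)
      (integrable_finsetSum _ fun a _ => (hci a).const_mul _),
      integral_finsetSum _ fun a _ => (hci a).const_mul _]
    congr 1
    refine Finset.sum_congr rfl fun a _ => ?_
    rw [integral_const_mul, mul_comm]
  rw [e1, dist_zero_right]
  have : ‖∫ n : S2, (F (y + r • (n : E3)) - ∑ a ∈ S, r ^ a * c a n) ∂dOmega‖ ≤
      (ε / (A + 1)) * A := by
    apply norm_integral_le_of_norm_le_const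
    refine Eventually.of_forall fun n => ?_
    have := hb r h0 hr n
    rw [hfin] at this
    simpa using this
  refine this.trans_lt ?_
  rw [div_mul_eq_mul_div, div_lt_iff₀ (by positivity)]
  nlinarith

lemma pf_finsum_eq (y : E3) (F : E3 → ℝ) (c : ℝ → S2 → ℝ) (h : HasSingExpansion y F c) (s : ℝ) :
    (∑ᶠ (a : ℝ) (_ : a < -3), s ^ (a + 3) / (a + 3) * ∫ n : S2, c a n ∂dOmega) =
    ∑ a ∈ (h.finite_exponents 0).toFinset with a < -3,
      s ^ (a + 3) / (a + 3) * ∫ n : S2, c a n ∂dOmega := by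
  apply finsum_cond_eq_sum_of_cond_iff
  intro a ha
  have : c a ≠ 0 := by
    intro h0; rw [h0] at ha; simp at ha
  simp only [Finset.mem_filter, Set.Finite.mem_toFinset, Set.mem_ofPred_eq]
  constructor
  · intro h; exact ⟨⟨by linarith, this⟩, h⟩
  · exact fun h => h.2

lemma pf_coeff_zero (y : E3) (F : E3 → ℝ) (c : ℝ → S2 → ℝ) (h : HasSingExpansion y F c) (a : ℝ)
    (ha : a ≤ 0) (hn : a ∉ (h.finite_exponents 0).toFinset) : ∫ n : S2, c a n ∂dOmega = 0 := by
  have : c a = 0 := by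
    by_contra h'
    exact hn (by simp [ha, h'])
  simp [this]

lemma pf_divergence (V : Fin 3 → E3 → ℝ) (hV : ∀ i, ContDiff ℝ 1 (V i))
    (hdec : ∀ i, Tendsto (fun x : E3 => ‖x‖ ^ 2 * V i x) (cocompact E3) (𝓝 0))
    (hint : Integrable (fun x => ∑ i : Fin 3, pder i (V i) x)) :
    ∫ x, ∑ i : Fin 3, pder i (V i) x = 0 := by
  let f : ContDiffBump (0 : E3) := ⟨1, 2, by norm_num, by norm_num⟩
  have hfs : ContDiff ℝ 1 (f : E3 → ℝ) := f.contDiff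
  have hfc : HasCompactSupport (f : E3 → ℝ) := f.hasCompactSupport
  have hf'c : Continuous (fderiv ℝ (f : E3 → ℝ)) := hfs.continuous_fderiv one_ne_zero
  obtain ⟨K, hK⟩ := hf'c.bounded_above_of_compact_support (hfc.fderiv ℝ)
  have hK0 : 0 ≤ K := (norm_nonneg _).trans (hK 0)
  set θ : ℕ → E3 → ℝ := fun k x => f (((k : ℝ) + 1)⁻¹ • x) with hθ
  have hθs : ∀ k, ContDiff ℝ 1 (θ k) := fun k => hfs.comp (contDiff_const_smul _)
  have hθc : ∀ k, HasCompactSupport (θ k) := fun k =>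
    hfc.comp_smul (inv_ne_zero (by positivity))
  have hθd : ∀ k x, fderiv ℝ (θ k) x = ((k : ℝ) + 1)⁻¹ • fderiv ℝ (f : E3 → ℝ) (((k : ℝ) + 1)⁻¹ • x) := by
    intro k x
    exact fderiv_comp_smul _
  -- vanishing region
  have hz1 : ∀ u : E3, ‖u‖ < 1 → fderiv ℝ (f : E3 → ℝ) u = 0 := by
    intro u hu
    have : (f : E3 → ℝ) =ᶠ[𝓝 u] fun _ => (1:ℝ) :=
      f.eventuallyEq_one_of_mem_ball (by simpa [f] using hu)
    rw [this.fderiv_eq]; simp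
  have hz2 : ∀ u : E3, 2 < ‖u‖ → fderiv ℝ (f : E3 → ℝ) u = 0 := by
    intro u hu
    apply image_eq_zero_of_notMem_tsupport
    intro h
    have := tsupport_fderiv_subset ℝ h
    rw [f.tsupport_eq] at this
    simp [f] at this
    linarith
  have hcd : ∀ i, Continuous (pder i (V i)) := fun i =>
    ((hV i).continuous_fderiv one_ne_zero).clm_apply continuous_const
  have hcθ : ∀ k i, Continuous (pder i (θ k)) := fun k i =>
    ((hθs k).continuous_fderiv one_ne_zero).clm_apply continuous_const
  have hcsθ : ∀ k i, HasCompactSupport (pder i (θ k)) := fun k i => (hθc k).fderiv_apply ℝ _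
  have hip : ∀ k i, ∫ x, θ k x * pder i (V i) x = - ∫ x, pder i (θ k) x * V i x := by
    intro k i
    apply integral_mul_fderiv_eq_neg_fderiv_mul_of_integrable
    · exact ((hcθ k i).mul (hV i).continuous).integrable_of_hasCompactSupport
        ((hcsθ k i).mul_right)
    · exact ((hθs k).continuous.mul (hcd i)).integrable_of_hasCompactSupport ((hθc k).mul_right)
    · exact ((hθs k).continuous.mul (hV i).continuous).integrable_of_hasCompactSupport
        ((hθc k).mul_right)
    · exact fun x _ => ((hθs k).differentiable one_ne_zero) x
    · exact fun x _ => ((hV i).differentiable one_ne_zero) x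
  have hsum : ∀ k, ∫ x, θ k x * ∑ i : Fin 3, pder i (V i) x =
      - ∑ i : Fin 3, ∫ x, pder i (θ k) x * V i x := by
    intro k
    simp only [Finset.mul_sum]
    have hi : ∀ i ∈ Finset.univ, Integrable (fun x => θ k x * pder i (V i) x) :=
      fun i _ => ((hθs k).continuous.mul
        (hcd i)).integrable_of_hasCompactSupport ((hθc k).mul_right)
    rw [integral_finsetSum _ hi, ← Finset.sum_neg_distrib]
    exact Finset.sum_congr rfl fun i _ => hip k i
  have lim1 : Tendsto (fun k => ∫ x, θ k x * ∑ i : Fin 3, pder i (V i) x) atTop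
      (𝓝 (∫ x, ∑ i : Fin 3, pder i (V i) x)) := by
    refine tendsto_integral_of_dominated_convergence (fun x => ‖∑ i : Fin 3, pder i (V i) x‖)
      ?_ hint.norm ?_ ?_
    · intro k
      exact ((hθs k).continuous.mul
        (continuous_finsetSum _ fun i _ => hcd i)).aestronglyMeasurable
    · intro k
      refine Eventually.of_forall fun x => ?_
      rw [norm_mul]
      refine mul_le_of_le_one_left (norm_nonneg _) ?_
      rw [Real.norm_eq_abs, abs_of_nonneg f.nonneg]
      exact f.le_one
    · refine Eventually.of_forall fun x => ?_
      refine tendsto_const_nhds.congr' ?_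
      filter_upwards [eventually_ge_atTop ⌈‖x‖⌉₊] with k hk
      have : θ k x = 1 := by
        apply f.one_of_mem_closedBall
        have hk' : ‖x‖ ≤ k := (Nat.le_ceil _).trans (by exact_mod_cast hk)
        simp only [mem_closedBall_zero_iff, f]
        rw [norm_smul, norm_inv, Real.norm_of_nonneg (by positivity), inv_mul_le_iff₀ (by positivity)]
        linarith
      rw [this, one_mul]
  have lim2 : ∀ i, Tendsto (fun k => ∫ x, pder i (θ k) x * V i x) atTop (𝓝 0) := by
    intro i
    rw [Metric.tendsto_nhds]
    intro ε hε
    set W := (volume : Measure E3).real (Metric.closedBall 0 1) with hW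
    have hW0 : 0 ≤ W := measureReal_nonneg
    set ε' := ε / (8 * K * W + 1) with hε'
    have hε'0 : 0 < ε' := by positivity
    have h1 : ∀ᶠ x in cocompact E3, |‖x‖ ^ 2 * V i x| < ε' := by
      have := (hdec i).abs
      rw [abs_zero] at this
      exact this.eventually (eventually_lt_nhds hε'0)
    rw [← Metric.cobounded_eq_cocompact, ← comap_norm_atTop, eventually_comap] at h1
    obtain ⟨R, hR⟩ := eventually_atTop.1 h1
    filter_upwards [eventually_ge_atTop ⌈R⌉₊] with k hk
    have hkR : R ≤ (k:ℝ) + 1 := by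
      have : R ≤ (k:ℝ) := (Nat.le_ceil _).trans (by exact_mod_cast hk)
      linarith
    set q : ℝ := (k : ℝ) + 1 with hq
    have hq0 : 0 < q := by positivity
    have hpt : ∀ x, ‖pder i (θ k) x * V i x‖ ≤ K * ε' / q ^ 3 := by
      intro x
      unfold pder
      rw [hθd]
      rcases lt_or_ge ‖x‖ q with h | h
      · rw [hz1]
        · simp; positivity
        · rw [norm_smul, norm_inv, Real.norm_of_nonneg hq0.le, inv_mul_lt_iff₀ hq0]; linarith
      · have hx0 : 0 < ‖x‖ := hq0.trans_le h
        have h3 := hR ‖x‖ (hkR.trans h) x rfl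
        rw [abs_mul, abs_of_nonneg (by positivity)] at h3
        have h4 : |V i x| ≤ ε' / q ^ 2 := by
          rw [le_div_iff₀ (by positivity)]
          have : q ^ 2 ≤ ‖x‖ ^ 2 := by gcongr
          nlinarith [abs_nonneg (V i x)]
        have h5 : ‖(fderiv ℝ (f : E3 → ℝ) (q⁻¹ • x)) (EuclideanSpace.single i 1)‖ ≤ K := by
          refine (ContinuousLinearMap.le_opNorm _ _).trans ?_
          simpa using hK _
        rw [smul_apply, smul_eq_mul, norm_mul, norm_mul, norm_inv,
          Real.norm_of_nonneg hq0.le, Real.norm_eq_abs (V i x)]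
        calc _ ≤ q⁻¹ * K * (ε' / q ^ 2) := by gcongr
          _ = _ := by field_simp
    have hsupp : ∀ x, x ∉ Metric.closedBall (0:E3) (2 * q) → pder i (θ k) x * V i x = 0 := by
      intro x hx
      unfold pder
      rw [hθd, hz2]
      · simp
      · rw [norm_smul, norm_inv, Real.norm_of_nonneg hq0.le, lt_inv_mul_iff₀ hq0]
        simp at hx; linarith
    rw [dist_zero_right, ← setIntegral_eq_integral_of_forall_compl_eq_zero hsupp]
    have hb := norm_setIntegral_le_of_norm_le_const (μ := volume)
      (s := Metric.closedBall (0:E3) (2 * q)) (C := K * ε' / q ^ 3)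
      (f := fun x => pder i (θ k) x * V i x) measure_closedBall_lt_top (fun x _ => hpt x)
    refine hb.trans_lt ?_
    have hvol : (volume : Measure E3).real (Metric.closedBall 0 (2 * q)) = (2 * q) ^ 3 * W := by
      rw [hW, Measure.addHaar_real_closedBall _ _ (by positivity),
        Measure.addHaar_real_closedBall _ _ zero_le_one]
      simp
    rw [hvol]
    have e : K * ε' / q ^ 3 * ((2 * q) ^ 3 * W) = 8 * K * W * ε' := by field_simp; ring
    rw [e, hε', mul_div_assoc', div_lt_iff₀ (by positivity)]
    nlinarith
  have lim3 : Tendsto (fun k => ∫ x, θ k x * ∑ i : Fin 3, pder i (V i) x) atTop (𝓝 0) := by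
    simp only [hsum]
    have := (tendsto_finsetSum Finset.univ fun i _ => lim2 i).neg
    simpa using this
  exact tendsto_nhds_unique lim1 lim3

/-- the Laplacian -/
def pfLap (F : E3 → ℝ) (x : E3) : ℝ := ∑ i : Fin 3, pder i (pder i F) x

lemma pf_pder_contDiffOn {U : Set E3} (hU : IsOpen U) {F : E3 → ℝ}
    (hF : ContDiffOn ℝ (⊤ : ℕ∞) F U) (i : Fin 3) : ContDiffOn ℝ (⊤ : ℕ∞) (pder i F) U := by
  unfold pder
  exact (hF.fderiv_of_isOpen hU (m := (⊤ : ℕ∞)) (by simp)).clm_apply contDiffOn_const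

lemma pf_lap_contDiffOn {U : Set E3} (hU : IsOpen U) {F : E3 → ℝ}
    (hF : ContDiffOn ℝ (⊤ : ℕ∞) F U) : ContDiffOn ℝ (⊤ : ℕ∞) (pfLap F) U := by
  unfold pfLap
  exact ContDiffOn.sum fun i _ => pf_pder_contDiffOn hU (pf_pder_contDiffOn hU hF i) i

lemma pf_mul_contDiff {U : Set E3} (hU : IsOpen U) {η g : E3 → ℝ}
    (hη : ContDiff ℝ (⊤ : ℕ∞) η) (hη0 : ∀ x, x ∉ U → η =ᶠ[𝓝 x] 0)
    (hg : ContDiffOn ℝ (⊤ : ℕ∞) g U) : ContDiff ℝ (⊤ : ℕ∞) (fun x => η x * g x) := by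
  rw [contDiff_iff_contDiffAt]
  intro x
  by_cases hx : x ∈ U
  · exact hη.contDiffAt.mul (hg.contDiffAt (hU.mem_nhds hx))
  · have : (fun x => η x * g x) =ᶠ[𝓝 x] fun _ => (0:ℝ) := by
      filter_upwards [hη0 x hx] with z hz
      simp [hz]
    exact contDiffAt_const.congr_of_eventuallyEq this

lemma pf_pder_eventually_zero {η : E3 → ℝ} {x : E3} (h : η =ᶠ[𝓝 x] 0) (i : Fin 3) :
    pder i η =ᶠ[𝓝 x] 0 := by
  filter_upwards [h.eventuallyEq_nhds] with z hz
  unfold pder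
  rw [hz.fderiv_eq]
  simp

lemma pf_core {U : Set E3} (hU : IsOpen U) {F : E3 → ℝ}
    (hF : ContDiffOn ℝ (⊤ : ℕ∞) F U)
    (hdec : ∀ i : Fin 3, Tendsto (fun x : E3 => ‖x‖ ^ 2 * pder i F x) (cocompact E3) (𝓝 0))
    (hint : ∃ R : ℝ, IntegrableOn (pfLap F) (Metric.closedBall 0 R)ᶜ volume)
    {η : E3 → ℝ} (hη : ContDiff ℝ (⊤ : ℕ∞) η) (hη0 : ∀ x, x ∉ U → η =ᶠ[𝓝 x] 0)
    (B : ℝ) (hB : ∀ x, |η x| ≤ B) (hcs : ∀ i, HasCompactSupport (pder i η)) :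
    Integrable (fun x => η x * pfLap F x) ∧
    (∀ i, Integrable (fun x => pder i η x * pder i F x)) ∧
    ∫ x, η x * pfLap F x = - ∫ x, ∑ i : Fin 3, pder i η x * pder i F x := by
  have hlapc : Continuous (fun x => η x * pfLap F x) :=
    (pf_mul_contDiff hU hη hη0 (pf_lap_contDiffOn hU hF)).continuous
  have hI1 : Integrable (fun x => η x * pfLap F x) := by
    obtain ⟨R, hR⟩ := hint
    rw [← integrableOn_univ, ← Set.union_compl_self (Metric.closedBall (0:E3) R)]
    refine IntegrableOn.union ?_ ?_
    · exact hlapc.continuousOn.integrableOn_compact (isCompact_closedBall 0 R)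
    · exact hR.bdd_mul hη.continuous.aestronglyMeasurable (c := B)
        (Eventually.of_forall fun x => hB x)
  have hpη : ∀ i, ContDiff ℝ (⊤ : ℕ∞) (pder i η) := fun i => by
    have := pf_pder_contDiffOn isOpen_univ hη.contDiffOn i
    exact contDiffOn_univ.1 this
  have hI2 : ∀ i, Integrable (fun x => pder i η x * pder i F x) := by
    intro i
    exact (pf_mul_contDiff hU (hpη i) (fun x hx => pf_pder_eventually_zero (hη0 x hx) i)
      (pf_pder_contDiffOn hU hF i)).continuous.integrable_of_hasCompactSupport (hcs i).mul_right
  refine ⟨hI1, hI2, ?_⟩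
  set V : Fin 3 → E3 → ℝ := fun i x => η x * pder i F x with hV
  have hVs : ∀ i, ContDiff ℝ (⊤ : ℕ∞) (V i) := fun i =>
    pf_mul_contDiff hU hη hη0 (pf_pder_contDiffOn hU hF i)
  have hVd : ∀ i x, pder i (V i) x = η x * pder i (pder i F) x + pder i η x * pder i F x := by
    intro i x
    by_cases hx : x ∈ U
    · have d1 : DifferentiableAt ℝ η x := hη.differentiable (by simp) x
      have d2 : DifferentiableAt ℝ (pder i F) x :=
        ((pf_pder_contDiffOn hU hF i).contDiffAt (hU.mem_nhds hx)).differentiableAt (by simp)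
      have := fderiv_fun_mul d1 d2
      unfold pder at this ⊢
      simp only [hV]
      unfold pder
      rw [this]
      simp
      ring
    · have h0 := hη0 x hx
      have hv : V i =ᶠ[𝓝 x] 0 := by
        filter_upwards [h0] with z hz
        simp [hV, hz]
      rw [(pf_pder_eventually_zero hv i).eq_of_nhds, h0.eq_of_nhds,
        (pf_pder_eventually_zero h0 i).eq_of_nhds]
      simp
  have hsum : ∀ x, ∑ i : Fin 3, pder i (V i) x =
      η x * pfLap F x + ∑ i : Fin 3, pder i η x * pder i F x := by
    intro x
    simp only [hVd, Finset.sum_add_distrib, pfLap, Finset.mul_sum]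
  have hI3 : Integrable (fun x => ∑ i : Fin 3, pder i η x * pder i F x) :=
    integrable_finsetSum _ fun i _ => hI2 i
  have hdiv := pf_divergence V (fun i => (hVs i).of_le (by norm_cast)) (by
    intro i
    have h1 := ((hdec i).norm.const_mul B)
    simp only [norm_zero, mul_zero] at h1
    refine squeeze_zero_norm (fun x => ?_) h1
    simp only [hV]
    rw [show ‖x‖ ^ 2 * (η x * pder i F x) = η x * (‖x‖ ^ 2 * pder i F x) by ring, norm_mul]
    exact mul_le_mul_of_nonneg_right (hB x) (norm_nonneg _)) (by
    simp only [hsum]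
    exact hI1.add hI3)
  simp only [hsum] at hdiv
  rw [integral_add hI1 hI3] at hdiv
  linarith

lemma pf_fderiv_sum (g : E3 → ℝ) (x v : E3) : fderiv ℝ g x v = ∑ i : Fin 3, v i * pder i g x := by
  have hv : v = ∑ i : Fin 3, v i • (EuclideanSpace.single i (1:ℝ) : E3) := by
    have := (EuclideanSpace.basisFun (Fin 3) ℝ).sum_repr v
    simpa using this.symm
  conv_lhs => rw [hv]
  rw [map_sum]
  simp [pder]

lemma pf_deriv_integral {U : Set E3} (hU : IsOpen U) (y : E3) (ρ : ℝ)
    (hyU : ∀ r, 0 < r → r < ρ → ∀ n : S2, y + r • (n : E3) ∈ U)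
    (g : E3 → ℝ) (hg : ContDiffOn ℝ (⊤ : ℕ∞) g U) (w : S2 → ℝ) (hw : Continuous w)
    (r : ℝ) (h0 : 0 < r) (hr : r < ρ) :
    HasDerivAt (fun t : ℝ => ∫ n : S2, w n * g (y + t • (n : E3)) ∂dOmega)
      (∫ n : S2, w n * fderiv ℝ g (y + r • (n : E3)) n ∂dOmega) r := by
  obtain ⟨a, ha0, har⟩ := exists_between h0
  obtain ⟨b, hrb, hbρ⟩ := exists_between hr
  have hmap : Continuous (fun p : ℝ × S2 => y + p.1 • (p.2 : E3)) := by fun_prop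
  have hgc : ContinuousOn g U := hg.continuousOn
  have hg'c : ContinuousOn (fderiv ℝ g) U := hg.continuousOn_fderiv_of_isOpen hU (by simp)
  have hmt : Set.MapsTo (fun p : ℝ × S2 => y + p.1 • (p.2 : E3)) (Set.Icc a b ×ˢ Set.univ) U := by
    rintro ⟨t, n⟩ ⟨ht, _⟩
    exact hyU t (ha0.trans_le ht.1) (ht.2.trans_lt hbρ) n
  have hc1 : ContinuousOn (fun p : ℝ × S2 => w p.2 * fderiv ℝ g (y + p.1 • (p.2 : E3)) p.2)
      (Set.Icc a b ×ˢ Set.univ) := by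
    refine (hw.comp continuous_snd).continuousOn.mul ?_
    exact (hg'c.comp hmap.continuousOn hmt).clm_apply (by fun_prop)
  have hc0 : ContinuousOn (fun p : ℝ × S2 => w p.2 * g (y + p.1 • (p.2 : E3)))
      (Set.Icc a b ×ˢ Set.univ) :=
    (hw.comp continuous_snd).continuousOn.mul (hgc.comp hmap.continuousOn hmt)
  obtain ⟨K, hK⟩ := (isCompact_Icc.prod isCompact_univ).exists_bound_of_continuousOn hc1
  have hslice : ∀ t ∈ Set.Icc a b, ∀ q : ℝ × S2 → ℝ, ContinuousOn q (Set.Icc a b ×ˢ Set.univ) →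
      Continuous (fun n => q (t, n)) := by
    intro t ht q hq
    rw [← continuousOn_univ]
    exact hq.comp (by fun_prop) (fun n _ => ⟨ht, Set.mem_univ _⟩)
  have hnb : Set.Ioo a b ∈ 𝓝 r := Ioo_mem_nhds har hrb
  have hrI : r ∈ Set.Icc a b := ⟨har.le, hrb.le⟩
  refine (hasDerivAt_integral_of_dominated_loc_of_deriv_le (μ := dOmega) (s := Set.Ioo a b)
    (F := fun t n => w n * g (y + t • (n : E3)))
    (F' := fun t n => w n * fderiv ℝ g (y + t • (n : E3)) n) (bound := fun _ => K)
    hnb ?_ ?_ ?_ ?_ ?_ ?_).2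
  · filter_upwards [hnb] with t ht
    exact (hslice t ⟨ht.1.le, ht.2.le⟩ _ hc0).aestronglyMeasurable
  · exact pf_smooth_sphere_integrable _ (hslice r hrI _ hc0)
  · exact (hslice r hrI _ hc1).aestronglyMeasurable
  · exact Eventually.of_forall fun n t ht => hK (t, n) ⟨⟨ht.1.le, ht.2.le⟩, Set.mem_univ _⟩
  · exact integrable_const _
  · refine Eventually.of_forall fun n t ht => ?_
    have hd : HasFDerivAt g (fderiv ℝ g (y + t • (n : E3))) (y + t • (n : E3)) :=
      ((hg.contDiffAt (hU.mem_nhds (hmt (x := (t, n)) ⟨⟨ht.1.le, ht.2.le⟩,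
        Set.mem_univ _⟩))).differentiableAt (by simp)).hasFDerivAt
    have hl : HasDerivAt (fun t : ℝ => y + t • (n : E3)) (n : E3) t := by
      have := ((hasDerivAt_id t).smul_const (n : E3)).const_add y
      simpa using this
    exact (hd.comp_hasDerivAt t hl).const_mul (w n)

/-- spherical average of the Laplacian -/
def pfL (y : E3) (F : E3 → ℝ) (r : ℝ) : ℝ := ∫ n : S2, pfLap F (y + r • (n : E3)) ∂dOmega
/-- spherical average of the radial derivative -/
def pfD (y : E3) (F : E3 → ℝ) (r : ℝ) : ℝ :=
  ∫ n : S2, (∑ i : Fin 3, (n : E3) i * pder i F (y + r • (n : E3))) ∂dOmega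
/-- flux -/
def pfH (y : E3) (F : E3 → ℝ) (r : ℝ) : ℝ := r ^ 2 * pfD y F r

lemma pf_slice_continuous {U : Set E3} (y : E3) (r : ℝ)
    (hyU : ∀ n : S2, y + r • (n : E3) ∈ U)
    (g : E3 → ℝ) (hg : ContDiffOn ℝ (⊤ : ℕ∞) g U) :
    Continuous (fun n : S2 => g (y + r • (n : E3))) := by
  rw [← continuousOn_univ]
  exact hg.continuousOn.comp (by fun_prop) (fun n _ => hyU n)

lemma pf_m_deriv {U : Set E3} (hU : IsOpen U) (y : E3) (ρ : ℝ)
    (hyU : ∀ r, 0 < r → r < ρ → ∀ n : S2, y + r • (n : E3) ∈ U)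
    (F : E3 → ℝ) (hF : ContDiffOn ℝ (⊤ : ℕ∞) F U) (r : ℝ) (h0 : 0 < r) (hr : r < ρ) :
    HasDerivAt (fun t : ℝ => ∫ n : S2, F (y + t • (n : E3)) ∂dOmega) (pfH y F r / r ^ 2) r := by
  have := pf_deriv_integral hU y ρ hyU F hF (fun _ => 1) continuous_const r h0 hr
  simp only [one_mul, pf_fderiv_sum] at this
  unfold pfH
  rw [mul_div_cancel_left₀ _ (by positivity)]
  exact this

lemma pf_L_diff {U : Set E3} (hU : IsOpen U) (y : E3) (ρ : ℝ)
    (hyU : ∀ r, 0 < r → r < ρ → ∀ n : S2, y + r • (n : E3) ∈ U)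
    (F : E3 → ℝ) (hF : ContDiffOn ℝ (⊤ : ℕ∞) F U) :
    ContinuousOn (pfL y F) (Set.Ioo 0 ρ) := by
  intro r hr
  have := pf_deriv_integral hU y ρ hyU (pfLap F) (pf_lap_contDiffOn hU hF) (fun _ => 1)
    continuous_const r hr.1 hr.2
  simp only [one_mul] at this
  exact this.continuousAt.continuousWithinAt

lemma pf_D_diff {U : Set E3} (hU : IsOpen U) (y : E3) (ρ : ℝ)
    (hyU : ∀ r, 0 < r → r < ρ → ∀ n : S2, y + r • (n : E3) ∈ U)
    (F : E3 → ℝ) (hF : ContDiffOn ℝ (⊤ : ℕ∞) F U) :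
    ∃ D' : ℝ → ℝ, ContinuousOn D' (Set.Ioo 0 ρ) ∧ ∀ r ∈ Set.Ioo 0 ρ, HasDerivAt (pfD y F) (D' r) r := by
  have hn : ∀ i : Fin 3, Continuous (fun n : S2 => (n : E3) i) := by intro i; fun_prop
  refine ⟨fun r => ∑ i : Fin 3, ∑ j : Fin 3, ∫ n : S2, ((n : E3) i * (n : E3) j) *
    pder j (pder i F) (y + r • (n : E3)) ∂dOmega, ?_, ?_⟩
  · refine continuousOn_finsetSum _ fun i _ => continuousOn_finsetSum _ fun j _ => ?_
    intro r hr
    exact (pf_deriv_integral hU y ρ hyU (pder j (pder i F))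
      (pf_pder_contDiffOn hU (pf_pder_contDiffOn hU hF i) j) (fun n => (n : E3) i * (n : E3) j)
      ((hn i).mul (hn j)) r hr.1 hr.2).continuousAt.continuousWithinAt
  · intro r hr
    have h1 : ∀ i : Fin 3, HasDerivAt (fun t : ℝ => ∫ n : S2, (n : E3) i *
        pder i F (y + t • (n : E3)) ∂dOmega)
        (∑ j : Fin 3, ∫ n : S2, ((n : E3) i * (n : E3) j) *
          pder j (pder i F) (y + r • (n : E3)) ∂dOmega) r := by
      intro i
      have := pf_deriv_integral hU y ρ hyU (pder i F)
        (pf_pder_contDiffOn hU hF i) (fun n => (n : E3) i) (hn i) r hr.1 hr.2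
      refine this.congr_deriv ?_
      rw [← integral_finsetSum]
      · refine integral_congr_ae (Eventually.of_forall fun n => ?_)
        simp only [pf_fderiv_sum, Finset.mul_sum, mul_assoc]
      · intro j _
        exact pf_smooth_sphere_integrable _ (((hn i).mul (hn j)).mul
          (pf_slice_continuous y r (hyU r hr.1 hr.2) _
            (pf_pder_contDiffOn hU (pf_pder_contDiffOn hU hF i) j)))
    have h2 := HasDerivAt.fun_sum (u := Finset.univ) fun i _ => h1 i
    refine h2.congr_of_eventuallyEq ?_
    filter_upwards [Ioo_mem_nhds hr.1 hr.2] with t ht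
    unfold pfD
    rw [integral_finsetSum]
    intro i _
    exact pf_smooth_sphere_integrable _ ((hn i).mul
          (pf_slice_continuous y t (hyU t ht.1 ht.2) _ (pf_pder_contDiffOn hU hF i)))

/-- radial function about `y` with profile `φ` -/
def pfRad (y : E3) (φ : ℝ → ℝ) (x : E3) : ℝ := φ ‖x - y‖

lemma pf_rad_apply (y : E3) (φ : ℝ → ℝ) (r : ℝ) (hr : 0 < r) (n : S2) :
    pfRad y φ (y + r • (n : E3)) = φ r := by
  unfold pfRad
  rw [add_sub_cancel_left, norm_smul, norm_eq_of_mem_sphere, mul_one, Real.norm_of_nonneg hr.le]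

lemma pf_rad_contDiff (y : E3) (φ : ℝ → ℝ) (hφ : ContDiff ℝ (⊤ : ℕ∞) φ) (c : ℝ)
    (h0 : φ =ᶠ[𝓝 0] fun _ => c) : ContDiff ℝ (⊤ : ℕ∞) (pfRad y φ) := by
  rw [contDiff_iff_contDiffAt]
  intro x
  by_cases hx : x = y
  · have hc : Tendsto (fun z : E3 => ‖z - y‖) (𝓝 x) (𝓝 0) := by
      have : Continuous (fun z : E3 => ‖z - y‖) := by fun_prop
      simpa [hx] using this.tendsto x
    exact (contDiffAt_const (c := c)).congr_of_eventuallyEq (hc.eventually h0)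
  · have h1 : ContDiffAt ℝ (⊤ : ℕ∞) (fun z : E3 => ‖z - y‖) x :=
      (contDiffAt_norm ℝ (sub_ne_zero.2 hx)).comp x (contDiffAt_id.sub contDiffAt_const)
    exact hφ.contDiffAt.comp x h1

lemma pf_rad_pder (y : E3) (φ : ℝ → ℝ) (hφ : Differentiable ℝ φ) (r : ℝ) (hr : 0 < r) (n : S2)
    (i : Fin 3) : pder i (pfRad y φ) (y + r • (n : E3)) = deriv φ r * (n : E3) i := by
  set x : E3 := y + r • (n : E3) with hx
  have hxy : x - y = r • (n : E3) := by simp [hx]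
  have hnorm : ‖x - y‖ = r := by
    rw [hxy, norm_smul, norm_eq_of_mem_sphere, mul_one, Real.norm_of_nonneg hr.le]
  have h1 : HasFDerivAt (fun z : E3 => ‖z - y‖ ^ 2) (2 • (innerSL ℝ) (x - y)) x := by
    have := (hasStrictFDerivAt_norm_sq (x - y)).hasFDerivAt.comp x ((hasFDerivAt_id x).sub_const y)
    rw [ContinuousLinearMap.comp_id] at this
    exact this
  have h2 := h1.sqrt (by rw [hnorm]; positivity)
  have h3 : (fun z : E3 => √(‖z - y‖ ^ 2)) = fun z => ‖z - y‖ := by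
    funext z; exact Real.sqrt_sq (norm_nonneg _)
  rw [h3] at h2
  have h4 := (hφ r).hasDerivAt
  rw [← hnorm] at h4
  have h5 := h4.comp_hasFDerivAt x h2
  unfold pder
  have h6 : fderiv ℝ (pfRad y φ) x = _ := h5.fderiv
  rw [h6, hnorm, hxy, Real.sqrt_sq hr.le]
  simp only [_root_.smul_apply, innerSL_apply_apply, smul_eq_mul, inner_smul_left,
    EuclideanSpace.inner_single_right, nsmul_eq_mul]
  simp
  field_simp
  simp

lemma pf_rad_zero (y : E3) (φ : ℝ → ℝ) (x : E3) (h : φ =ᶠ[𝓝 ‖x - y‖] 0) : pfRad y φ =ᶠ[𝓝 x] 0 := by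
  have hc : Continuous (fun z : E3 => ‖z - y‖) := by fun_prop
  exact (hc.tendsto x).eventually h

lemma pf_polar_lap (y : E3) (φ : ℝ → ℝ) (F : E3 → ℝ)
    (h : Integrable (fun x => pfRad y φ x * pfLap F x)) :
    ∫ x, pfRad y φ x * pfLap F x = ∫ r in Set.Ioi 0, φ r * (r ^ 2 * pfL y F r) := by
  rw [pf_polar y _ h]
  refine setIntegral_congr_fun measurableSet_Ioi fun r hr => ?_
  simp only [pf_rad_apply y φ r hr, integral_const_mul, pfL]
  ring

lemma pf_polar_grad (y : E3) (φ : ℝ → ℝ) (hφ : Differentiable ℝ φ) (F : E3 → ℝ)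
    (h : Integrable (fun x => ∑ i : Fin 3, pder i (pfRad y φ) x * pder i F x)) :
    ∫ x, ∑ i : Fin 3, pder i (pfRad y φ) x * pder i F x
      = ∫ r in Set.Ioi 0, deriv φ r * pfH y F r := by
  rw [pf_polar y _ h]
  refine setIntegral_congr_fun measurableSet_Ioi fun r hr => ?_
  simp only [pf_rad_pder y φ hφ r hr, mul_assoc, ← Finset.mul_sum, integral_const_mul, pfH, pfD]
  ring

lemma pf_cs_integrable {V : Set ℝ} (hV : IsOpen V) (φ g : ℝ → ℝ) (hφ : Continuous φ)
    (hc : HasCompactSupport φ) (hs : tsupport φ ⊆ V) (hg : ContinuousOn g V) :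
    Integrable (fun r => φ r * g r) :=
  Continuous.integrable_of_hasCompactSupport
    ((hφ.continuousOn.mul hg).continuous_of_tsupport_subset hV
      ((tsupport_mul_subset_left).trans hs)) hc.mul_right

lemma pf_ode {U : Set E3} (hU : IsOpen U) {F : E3 → ℝ}
    (hF : ContDiffOn ℝ (⊤ : ℕ∞) F U)
    (hdec : ∀ i : Fin 3, Tendsto (fun x : E3 => ‖x‖ ^ 2 * pder i F x) (cocompact E3) (𝓝 0))
    (hint : ∃ R : ℝ, IntegrableOn (pfLap F) (Metric.closedBall 0 R)ᶜ volume)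
    (y : E3) (ρ : ℝ) (hyU : ∀ x, 0 < ‖x - y‖ → ‖x - y‖ < ρ → x ∈ U)
    (r : ℝ) (h0 : 0 < r) (hr : r < ρ) :
    HasDerivAt (pfH y F) (r ^ 2 * pfL y F r) r := by
  have hyU' : ∀ r, 0 < r → r < ρ → ∀ n : S2, y + r • (n : E3) ∈ U := by
    intro r h0 hr n
    have : ‖y + r • (n : E3) - y‖ = r := by
      rw [add_sub_cancel_left, norm_smul, norm_eq_of_mem_sphere, mul_one, Real.norm_of_nonneg h0.le]
    exact hyU _ (by rw [this]; exact h0) (by rw [this]; exact hr)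
  obtain ⟨D', hD'c, hD'⟩ := pf_D_diff hU y ρ hyU' F hF
  have hLc := pf_L_diff hU y ρ hyU' F hF
  set H' : ℝ → ℝ := fun r => 2 * r * pfD y F r + r ^ 2 * D' r with hH'
  have hDc : ContinuousOn (pfD y F) (Set.Ioo 0 ρ) := fun t ht =>
    (hD' t ht).continuousAt.continuousWithinAt
  have hHd : ∀ t ∈ Set.Ioo 0 ρ, HasDerivAt (pfH y F) (H' t) t := by
    intro t ht
    have := (hasDerivAt_pow 2 t).mul (hD' t ht)
    refine this.congr_deriv ?_
    simp [hH']
  have hH'c : ContinuousOn H' (Set.Ioo 0 ρ) := by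
    have e1 : ContinuousOn (fun t : ℝ => 2 * t) (Set.Ioo 0 ρ) := by fun_prop
    have e2 : ContinuousOn (fun t : ℝ => t ^ 2) (Set.Ioo 0 ρ) := by fun_prop
    exact (e1.mul hDc).add (e2.mul hD'c)
  have hHc : ContinuousOn (pfH y F) (Set.Ioo 0 ρ) := fun t ht =>
    (hHd t ht).continuousAt.continuousWithinAt
  have hL2c : ContinuousOn (fun t => t ^ 2 * pfL y F t) (Set.Ioo 0 ρ) := by
    have e2 : ContinuousOn (fun t : ℝ => t ^ 2) (Set.Ioo 0 ρ) := by fun_prop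
    exact e2.mul hLc
  have hKc : ContinuousOn (fun t => t ^ 2 * pfL y F t - H' t) (Set.Ioo 0 ρ) := hL2c.sub hH'c
  have hae : ∀ᵐ t : ℝ, t ∈ Set.Ioo 0 ρ → t ^ 2 * pfL y F t - H' t = 0 := by
    refine isOpen_Ioo.ae_eq_zero_of_integral_contDiff_smul_eq_zero
      (hKc.locallyIntegrableOn measurableSet_Ioo) ?_
    intro φ hφ hφc hφs
    have hφd : Differentiable ℝ φ := hφ.differentiable (by simp)
    have hφ'c : Continuous (deriv φ) := hφ.continuous_deriv (by simp)
    have hφ's : tsupport (deriv φ) ⊆ Set.Ioo 0 ρ := (tsupport_deriv_subset).trans hφs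
    have hz : ∀ t, t ∉ Set.Ioo 0 ρ → φ =ᶠ[𝓝 t] 0 := fun t ht =>
      notMem_tsupport_iff_eventuallyEq.1 (fun h => ht (hφs h))
    have I1 := pf_cs_integrable isOpen_Ioo φ _ hφ.continuous hφc hφs hL2c
    have I2 := pf_cs_integrable isOpen_Ioo φ _ hφ.continuous hφc hφs hH'c
    have I3 := pf_cs_integrable isOpen_Ioo φ _ hφ.continuous hφc hφs hHc
    have I4 := pf_cs_integrable isOpen_Ioo (deriv φ) _ hφ'c hφc.deriv hφ's hHc
    have P : ∫ t, (deriv φ t * pfH y F t + φ t * H' t) = 0 := by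
      refine integral_eq_zero_of_hasDerivAt_of_integrable (f := fun t => φ t * pfH y F t)
        ?_ (I4.add I2) I3
      intro t
      by_cases ht : t ∈ Set.Ioo 0 ρ
      · exact (hφd t).hasDerivAt.mul (hHd t ht)
      · have hz' := hz t ht
        have : (fun t => φ t * pfH y F t) =ᶠ[𝓝 t] fun _ => 0 := by
          filter_upwards [hz'] with u hu
          simp [hu]
        rw [hz'.deriv_eq, hz'.eq_of_nhds]
        simpa using (hasDerivAt_const t (0:ℝ)).congr_of_eventuallyEq this
    obtain ⟨Bd, hBd⟩ := hφc.exists_bound_of_continuous hφ.continuous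
    have hηz : ∀ x, ¬ (0 < ‖x - y‖ ∧ ‖x - y‖ < ρ) → pfRad y φ =ᶠ[𝓝 x] 0 := fun x hx =>
      pf_rad_zero y φ x (hz _ hx)
    have Q := pf_core hU hF hdec hint
      (pf_rad_contDiff y φ hφ 0 (hz 0 (by simp))) (fun x hx => hηz x (fun h => hx (hyU x h.1 h.2)))
      Bd (fun x => hBd _) (fun i => by
        refine HasCompactSupport.intro (isCompact_closedBall y ρ) fun x hx => ?_
        refine (pf_pder_eventually_zero (hηz x fun h => hx ?_) i).eq_of_nhds
        rw [Metric.mem_closedBall, dist_eq_norm]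
        exact h.2.le)
    obtain ⟨q1, q2, q3⟩ := Q
    rw [pf_polar_lap y φ F q1, pf_polar_grad y φ hφd F (integrable_finsetSum _ fun i _ => q2 i),
      setIntegral_eq_integral_of_forall_compl_eq_zero,
      setIntegral_eq_integral_of_forall_compl_eq_zero] at q3
    · rw [integral_add I4 I2] at P
      simp only [smul_eq_mul, mul_sub]
      rw [integral_sub I1 I2]
      linarith
    · intro t ht
      rw [(hz t (fun h => ht h.1)).deriv_eq]
      simp
    · intro t ht
      rw [(hz t (fun h => ht h.1)).eq_of_nhds]
      simp
  have heq : Set.EqOn (fun t => t ^ 2 * pfL y F t) H' (Set.Ioo 0 ρ) := by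
    refine Measure.eqOn_open_of_ae_eq (μ := volume) ?_ isOpen_Ioo hL2c hH'c
    refine (ae_restrict_iff' measurableSet_Ioo).2 ?_
    filter_upwards [hae] with t ht hti
    exact sub_eq_zero.1 (ht hti)
  have := hHd r ⟨h0, hr⟩
  rwa [← heq ⟨h0, hr⟩] at this

/-- radial cutoff profile: `1` for `r ≤ ρ/3`, `0` for `r ≥ 2ρ/3` -/
def pfChi (ρ : ℝ) (r : ℝ) : ℝ := Real.smoothTransition (2 - 3 * r / ρ)

lemma pf_chi_contDiff (ρ : ℝ) : ContDiff ℝ (⊤ : ℕ∞) (pfChi ρ) := by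
  unfold pfChi
  exact Real.smoothTransition.contDiff.comp (by fun_prop)

lemma pf_chi_one {ρ r : ℝ} (hρ : 0 < ρ) (h : r ≤ ρ / 3) : pfChi ρ r = 1 := by
  refine Real.smoothTransition.one_of_one_le ?_
  have : 3 * r / ρ ≤ 1 := by rw [div_le_one hρ]; linarith
  linarith

lemma pf_chi_zero {ρ r : ℝ} (hρ : 0 < ρ) (h : 2 * ρ / 3 ≤ r) : pfChi ρ r = 0 := by
  refine Real.smoothTransition.zero_of_nonpos ?_
  have : 2 ≤ 3 * r / ρ := by rw [le_div_iff₀ hρ]; linarith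
  linarith

lemma pf_chi_ev_one {ρ r : ℝ} (hρ : 0 < ρ) (h : r < ρ / 3) : pfChi ρ =ᶠ[𝓝 r] fun _ => 1 := by
  filter_upwards [Iio_mem_nhds h] with t ht
  exact pf_chi_one hρ (le_of_lt ht)

lemma pf_chi_ev_zero {ρ r : ℝ} (hρ : 0 < ρ) (h : 2 * ρ / 3 < r) : pfChi ρ =ᶠ[𝓝 r] 0 := by
  filter_upwards [Ioi_mem_nhds h] with t ht
  exact pf_chi_zero hρ (le_of_lt ht)

lemma pf_chi_smooth (y : E3) {ρ : ℝ} (hρ : 0 < ρ) :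
    ContDiff ℝ (⊤ : ℕ∞) (pfRad y (pfChi ρ)) :=
  pf_rad_contDiff y _ (pf_chi_contDiff ρ) 1 (pf_chi_ev_one hρ (by positivity))

lemma pf_chi_pder_zero (y : E3) {ρ : ℝ} (hρ : 0 < ρ) (i : Fin 3) (x : E3)
    (hx : ¬ (0 < ‖x - y‖ ∧ ‖x - y‖ < ρ)) : pder i (pfRad y (pfChi ρ)) =ᶠ[𝓝 x] 0 := by
  by_cases h : 0 < ‖x - y‖
  · have h2 : ρ ≤ ‖x - y‖ := not_lt.1 fun h' => hx ⟨h, h'⟩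
    exact pf_pder_eventually_zero (pf_rad_zero y _ x (pf_chi_ev_zero hρ (by linarith))) i
  · have h0 : ‖x - y‖ = 0 := le_antisymm (not_lt.1 h) (norm_nonneg _)
    have hc : Continuous (fun z : E3 => ‖z - y‖) := by fun_prop
    have h1 : pfRad y (pfChi ρ) =ᶠ[𝓝 x] fun _ => 1 :=
      (hc.tendsto x).eventually (pf_chi_ev_one hρ (by rw [h0]; positivity))
    filter_upwards [h1.eventuallyEq_nhds] with z hz
    unfold pder
    rw [hz.fderiv_eq]
    simp

lemma pf_chi_pder_cs (y : E3) {ρ : ℝ} (hρ : 0 < ρ) (i : Fin 3) :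
    HasCompactSupport (pder i (pfRad y (pfChi ρ))) := by
  refine HasCompactSupport.intro (isCompact_closedBall y ρ) fun x hx => ?_
  refine (pf_chi_pder_zero y hρ i x fun h => hx ?_).eq_of_nhds
  rw [Metric.mem_closedBall, dist_eq_norm]
  exact h.2.le

lemma pf_point {U : Set E3} (hU : IsOpen U) {F : E3 → ℝ}
    (hF : ContDiffOn ℝ (⊤ : ℕ∞) F U)
    (hdec : ∀ i : Fin 3, Tendsto (fun x : E3 => ‖x‖ ^ 2 * pder i F x) (cocompact E3) (𝓝 0))
    (hint : ∃ R : ℝ, IntegrableOn (pfLap F) (Metric.closedBall 0 R)ᶜ volume)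
    (y : E3) (ρ : ℝ) (hρ : 0 < ρ) (hyU : ∀ x, 0 < ‖x - y‖ → ‖x - y‖ < ρ → x ∈ U)
    (s : ℝ) (h0 : 0 < s) (hs : s < ρ / 3) :
    IntegrableOn (fun x => pfRad y (pfChi ρ) x * pfLap F x) (Metric.closedBall y s)ᶜ ∧
    (Integrable fun x => ∑ i : Fin 3, pder i (pfRad y (pfChi ρ)) x * pder i F x) ∧
    (∫ x, ∑ i : Fin 3, pder i (pfRad y (pfChi ρ)) x * pder i F x) +
      ∫ x in (Metric.closedBall y s)ᶜ, pfRad y (pfChi ρ) x * pfLap F x = - pfH y F s := by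
  have hyU' : ∀ r, 0 < r → r < ρ → ∀ n : S2, y + r • (n : E3) ∈ U := by
    intro r h0 hr n
    have : ‖y + r • (n : E3) - y‖ = r := by
      rw [add_sub_cancel_left, norm_smul, norm_eq_of_mem_sphere, mul_one, Real.norm_of_nonneg h0.le]
    exact hyU _ (by rw [this]; exact h0) (by rw [this]; exact hr)
  have hsm := pf_chi_smooth y hρ
  set b : ℝ := 2 * ρ / 3 with hb
  have hχd : Differentiable ℝ (pfChi ρ) := (pf_chi_contDiff ρ).differentiable (by simp)
  -- integrability
  have J1 : IntegrableOn (fun x => pfRad y (pfChi ρ) x * pfLap F x) (Metric.closedBall y s)ᶜ := by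
    have hK : IsCompact (Metric.closedBall y b \ Metric.ball y s) :=
      (isCompact_closedBall y b).diff Metric.isOpen_ball
    have hKU : Metric.closedBall y b \ Metric.ball y s ⊆ U := by
      rintro x ⟨hx1, hx2⟩
      rw [Metric.mem_closedBall, dist_eq_norm] at hx1
      rw [Metric.mem_ball, dist_eq_norm, not_lt] at hx2
      exact hyU x (by linarith) (by linarith)
    have j1 : IntegrableOn (fun x => pfRad y (pfChi ρ) x * pfLap F x)
        (Metric.closedBall y b \ Metric.ball y s) :=
      (hsm.continuous.continuousOn.mul
        ((pf_lap_contDiffOn hU hF).continuousOn.mono hKU)).integrableOn_compact hK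
    have j2 : IntegrableOn (fun x => pfRad y (pfChi ρ) x * pfLap F x) (Metric.closedBall y b)ᶜ := by
      refine integrableOn_zero.congr_fun ?_ Metric.isClosed_closedBall.measurableSet.compl
      intro x hx
      rw [Set.mem_compl_iff, Metric.mem_closedBall, dist_eq_norm, not_le] at hx
      simp only [pfRad]
      rw [pf_chi_zero hρ hx.le]
      simp
    refine (j1.union j2).mono_set ?_
    intro x hx
    by_cases hxb : x ∈ Metric.closedBall y b
    · exact Or.inl ⟨hxb, fun h => hx (Metric.ball_subset_closedBall h)⟩
    · exact Or.inr hxb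
  have J2 : Integrable fun x => ∑ i : Fin 3, pder i (pfRad y (pfChi ρ)) x * pder i F x := by
    refine integrable_finsetSum _ fun i _ => ?_
    have : ContDiff ℝ (⊤ : ℕ∞) (pder i (pfRad y (pfChi ρ))) :=
      contDiffOn_univ.1 (pf_pder_contDiffOn isOpen_univ hsm.contDiffOn i)
    exact (pf_mul_contDiff hU this
      (fun x hx => pf_chi_pder_zero y hρ i x fun h => hx (hyU x h.1 h.2))
      (pf_pder_contDiffOn hU hF i)).continuous.integrable_of_hasCompactSupport
        (pf_chi_pder_cs y hρ i).mul_right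
  refine ⟨J1, J2, ?_⟩
  have hms : MeasurableSet (Metric.closedBall y s)ᶜ := Metric.isClosed_closedBall.measurableSet.compl
  have hsb : s ≤ b := by rw [hb]; linarith
  have hind : (Metric.closedBall y s)ᶜ.indicator (fun x => pfRad y (pfChi ρ) x * pfLap F x) =
      fun x => pfRad y ((Set.Ioi s).indicator (pfChi ρ)) x * pfLap F x := by
    funext x
    by_cases hx : s < ‖x - y‖
    · rw [Set.indicator_of_mem (by
        rw [Set.mem_compl_iff, Metric.mem_closedBall, dist_eq_norm]; exact not_le.2 hx)]
      simp only [pfRad]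
      rw [Set.indicator_of_mem (by exact hx)]
    · rw [Set.indicator_of_notMem (by
        rw [Set.mem_compl_iff, Metric.mem_closedBall, dist_eq_norm, not_not]; exact not_lt.1 hx)]
      simp only [pfRad]
      rw [Set.indicator_of_notMem (by exact hx), zero_mul]
  have e1 : ∫ x in (Metric.closedBall y s)ᶜ, pfRad y (pfChi ρ) x * pfLap F x =
      ∫ r in s..b, pfChi ρ r * (r ^ 2 * pfL y F r) := by
    rw [← integral_indicator hms, hind, pf_polar_lap, intervalIntegral.integral_of_le hsb,
      setIntegral_eq_of_subset_of_forall_sdiff_eq_zero measurableSet_Ioi (s := Set.Ioc s b)]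
    · refine setIntegral_congr_fun measurableSet_Ioc fun r hr => ?_
      rw [Set.indicator_of_mem (by exact hr.1)]
    · exact fun r hr => h0.trans hr.1
    · rintro r ⟨hr1, hr2⟩
      by_cases h : s < r
      · have hbr : b < r := not_le.1 fun h' => hr2 ⟨h, h'⟩
        rw [Set.indicator_of_mem (by exact h), pf_chi_zero hρ hbr.le, zero_mul]
      · rw [Set.indicator_of_notMem (by exact h), zero_mul]
    · rw [← hind]
      exact (integrable_indicator_iff hms).2 J1
  have e2 : ∫ x, ∑ i : Fin 3, pder i (pfRad y (pfChi ρ)) x * pder i F x =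
      ∫ r in s..b, deriv (pfChi ρ) r * pfH y F r := by
    rw [pf_polar_grad y _ hχd F J2, intervalIntegral.integral_of_le hsb,
      setIntegral_eq_of_subset_of_forall_sdiff_eq_zero measurableSet_Ioi (s := Set.Ioc s b)]
    · exact fun r hr => h0.trans hr.1
    · rintro r ⟨hr1, hr2⟩
      by_cases h : s < r
      · have hbr : b < r := not_le.1 fun h' => hr2 ⟨h, h'⟩
        rw [(pf_chi_ev_zero hρ hbr).deriv_eq]
        simp
      · rw [(pf_chi_ev_one hρ ((not_lt.1 h).trans_lt hs)).deriv_eq]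
        simp
  have hIcc : ∀ r ∈ Set.uIcc s b, 0 < r ∧ r < ρ := by
    intro r hr
    rw [Set.uIcc_of_le hsb] at hr
    exact ⟨h0.trans_le hr.1, hr.2.trans_lt (by rw [hb]; linarith)⟩
  have ibp := intervalIntegral.integral_mul_deriv_eq_deriv_mul (a := s) (b := b)
    (u := pfChi ρ) (u' := deriv (pfChi ρ)) (v := pfH y F) (v' := fun r => r ^ 2 * pfL y F r)
    (fun r _ => (hχd r).hasDerivAt)
    (fun r hr => pf_ode hU hF hdec hint y ρ hyU r (hIcc r hr).1 (hIcc r hr).2)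
    (((pf_chi_contDiff ρ).continuous_deriv (by simp)).intervalIntegrable _ _)
    (by
      refine ContinuousOn.intervalIntegrable ?_
      have e2 : ContinuousOn (fun t : ℝ => t ^ 2) (Set.uIcc s b) := by fun_prop
      exact e2.mul ((pf_L_diff hU y ρ hyU' F hF).mono fun r hr => hIcc r hr))
  rw [e1, e2, ibp, pf_chi_zero hρ le_rfl, pf_chi_one hρ hs.le]
  ring

lemma pf_total {y₁ y₂ : E3} (hy : y₁ ≠ y₂) {F : E3 → ℝ}
    (hF : ContDiffOn ℝ (⊤ : ℕ∞) F ({y₁, y₂}ᶜ : Set E3))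
    (hdec : ∀ i : Fin 3, Tendsto (fun x : E3 => ‖x‖ ^ 2 * pder i F x) (cocompact E3) (𝓝 0))
    (hint : ∃ R : ℝ, IntegrableOn (pfLap F) (Metric.closedBall 0 R)ᶜ volume)
    (ρ : ℝ) (hρ : 0 < ρ) (hd : 2 * ρ ≤ ‖y₁ - y₂‖)
    (hy1 : ∀ x, 0 < ‖x - y₁‖ → ‖x - y₁‖ < ρ → x ∈ ({y₁, y₂}ᶜ : Set E3))
    (hy2 : ∀ x, 0 < ‖x - y₂‖ → ‖x - y₂‖ < ρ → x ∈ ({y₁, y₂}ᶜ : Set E3))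
    (s : ℝ) (h0 : 0 < s) (hs : s < ρ / 3) :
    ∫ x in (Metric.closedBall y₁ s ∪ Metric.closedBall y₂ s)ᶜ, pfLap F x
      = - pfH y₁ F s - pfH y₂ F s := by
  have hU : IsOpen ({y₁, y₂}ᶜ : Set E3) := (Set.toFinite {y₁, y₂}).isClosed.isOpen_compl
  obtain ⟨a1, a2, a3⟩ := pf_point hU hF hdec hint y₁ ρ hρ hy1 s h0 hs
  obtain ⟨b1, b2, b3⟩ := pf_point hU hF hdec hint y₂ ρ hρ hy2 s h0 hs
  set χ₁ := pfRad y₁ (pfChi ρ) with hχ₁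
  set χ₂ := pfRad y₂ (pfChi ρ) with hχ₂
  have c1 : ContDiff ℝ (⊤ : ℕ∞) χ₁ := pf_chi_smooth y₁ hρ
  have c2 : ContDiff ℝ (⊤ : ℕ∞) χ₂ := pf_chi_smooth y₂ hρ
  have tri : ∀ x, 2 * ρ ≤ ‖x - y₁‖ + ‖x - y₂‖ := fun x => by
    have : ‖y₁ - y₂‖ ≤ ‖x - y₁‖ + ‖x - y₂‖ := by
      rw [show y₁ - y₂ = (x - y₂) - (x - y₁) by abel, add_comm]
      exact norm_sub_le _ _
    linarith
  have near1 : ∀ x, ‖x - y₁‖ < ρ / 3 → χ₁ x = 1 ∧ χ₂ x = 0 := fun x hx =>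
    ⟨pf_chi_one hρ hx.le, pf_chi_zero hρ (by have := tri x; linarith)⟩
  have near2 : ∀ x, ‖x - y₂‖ < ρ / 3 → χ₁ x = 0 ∧ χ₂ x = 1 := fun x hx =>
    ⟨pf_chi_zero hρ (by have := tri x; linarith), pf_chi_one hρ hx.le⟩
  set η : E3 → ℝ := fun x => 1 - χ₁ x - χ₂ x with hη
  have hηs : ContDiff ℝ (⊤ : ℕ∞) η := (contDiff_const.sub c1).sub c2
  have hpd : ∀ i x, pder i η x = - pder i χ₁ x - pder i χ₂ x := by
    intro i x
    have d1 : DifferentiableAt ℝ χ₁ x := c1.differentiable (by simp) x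
    have d2 : DifferentiableAt ℝ χ₂ x := c2.differentiable (by simp) x
    have : HasFDerivAt η (0 - fderiv ℝ χ₁ x - fderiv ℝ χ₂ x) x :=
      ((hasFDerivAt_const (1:ℝ) x).sub d1.hasFDerivAt).sub d2.hasFDerivAt
    unfold pder
    rw [this.fderiv]
    simp
  have core := pf_core hU hF hdec hint hηs (by
    intro x hx
    simp only [Set.mem_compl_iff, not_not, Set.mem_insert_iff, Set.mem_singleton_iff] at hx
    rcases hx with rfl | rfl
    · filter_upwards [Metric.ball_mem_nhds x (show 0 < ρ / 3 by positivity)] with z hz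
      rw [Metric.mem_ball, dist_eq_norm] at hz
      simp [hη, near1 z hz]
    · filter_upwards [Metric.ball_mem_nhds x (show 0 < ρ / 3 by positivity)] with z hz
      rw [Metric.mem_ball, dist_eq_norm] at hz
      simp [hη, near2 z hz]) 3 (by
    intro x
    have p1 : 0 ≤ χ₁ x := Real.smoothTransition.nonneg _
    have p2 : χ₁ x ≤ 1 := Real.smoothTransition.le_one _
    have p3 : 0 ≤ χ₂ x := Real.smoothTransition.nonneg _
    have p4 : χ₂ x ≤ 1 := Real.smoothTransition.le_one _
    rw [abs_le]
    constructor <;> simp only [hη] <;> linarith) (by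
    intro i
    have : pder i η = fun x => - pder i χ₁ x - pder i χ₂ x := funext (hpd i)
    rw [this]
    refine HasCompactSupport.intro ((isCompact_closedBall y₁ ρ).union (isCompact_closedBall y₂ ρ))
      fun x hx => ?_
    rw [Set.mem_union, not_or, Metric.mem_closedBall, Metric.mem_closedBall, dist_eq_norm,
      dist_eq_norm] at hx
    rw [(pf_chi_pder_zero y₁ hρ i x fun h => hx.1 h.2.le).eq_of_nhds,
      (pf_chi_pder_zero y₂ hρ i x fun h => hx.2 h.2.le).eq_of_nhds]
    simp)
  obtain ⟨k1, k2, k3⟩ := core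
  have k4 : ∫ x, η x * pfLap F x = (∫ x, ∑ i : Fin 3, pder i χ₁ x * pder i F x) +
      ∫ x, ∑ i : Fin 3, pder i χ₂ x * pder i F x := by
    rw [k3, ← integral_add a2 b2, ← integral_neg]
    refine integral_congr_ae (Eventually.of_forall fun x => ?_)
    simp only [hpd, ← Finset.sum_add_distrib, ← Finset.sum_neg_distrib]
    refine Finset.sum_congr rfl fun i _ => ?_
    ring
  have m1 : MeasurableSet (Metric.closedBall y₁ s)ᶜ := Metric.isClosed_closedBall.measurableSet.compl
  have m2 : MeasurableSet (Metric.closedBall y₂ s)ᶜ := Metric.isClosed_closedBall.measurableSet.compl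
  have m3 : MeasurableSet (Metric.closedBall y₁ s ∪ Metric.closedBall y₂ s)ᶜ :=
    (Metric.isClosed_closedBall.measurableSet.union Metric.isClosed_closedBall.measurableSet).compl
  have key : ∫ x in (Metric.closedBall y₁ s ∪ Metric.closedBall y₂ s)ᶜ, pfLap F x =
      (∫ x, η x * pfLap F x) + (∫ x in (Metric.closedBall y₁ s)ᶜ, χ₁ x * pfLap F x)
      + ∫ x in (Metric.closedBall y₂ s)ᶜ, χ₂ x * pfLap F x := by
    have i1 := (integrable_indicator_iff m1).2 a1
    have i2 := (integrable_indicator_iff m2).2 b1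
    have i12 : Integrable (fun a => η a * pfLap F a +
      (Metric.closedBall y₁ s)ᶜ.indicator (fun x => χ₁ x * pfLap F x) a) := k1.add i1
    rw [← integral_indicator m1, ← integral_indicator m2, ← integral_indicator m3,
      ← integral_add k1 i1, ← integral_add i12 i2]
    refine integral_congr_ae (Eventually.of_forall fun x => ?_)
    simp only [Set.indicator, Set.mem_compl_iff, Set.mem_union, Metric.mem_closedBall,
      dist_eq_norm]
    by_cases q1 : ‖x - y₁‖ ≤ s
    · have := near1 x (by linarith)
      simp [q1, hη, this]
    · by_cases q2 : ‖x - y₂‖ ≤ s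
      · have := near2 x (by linarith)
        simp [q2, hη, this]
      · simp only [q1, q2, or_self, not_false_eq_true, if_true, hη]
        ring
  rw [key, k4]
  linarith

lemma pf_point_limit {U : Set E3} (hU : IsOpen U) {F : E3 → ℝ}
    (hF : ContDiffOn ℝ (⊤ : ℕ∞) F U)
    (hdec : ∀ i : Fin 3, Tendsto (fun x : E3 => ‖x‖ ^ 2 * pder i F x) (cocompact E3) (𝓝 0))
    (hint : ∃ R : ℝ, IntegrableOn (pfLap F) (Metric.closedBall 0 R)ᶜ volume)
    (y : E3) (ρ : ℝ) (hρ : 0 < ρ) (hyU : ∀ x, 0 < ‖x - y‖ → ‖x - y‖ < ρ → x ∈ U)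
    (c cΔ : ℝ → S2 → ℝ) (hc : HasSingExpansion y F c) (hcΔ : HasSingExpansion y (pfLap F) cΔ)
    (s₁ : ℝ) :
    Tendsto (fun s => - pfH y F s +
      (∑ᶠ (a : ℝ) (_ : a < -3), s ^ (a + 3) / (a + 3) * ∫ n : S2, cΔ a n ∂dOmega) +
      Real.log (s / s₁) * ∫ n : S2, cΔ (-3) n ∂dOmega) (𝓝[>] 0)
      (𝓝 (∫ n : S2, c (-1) n ∂dOmega)) := by
  have hyU' : ∀ r, 0 < r → r < ρ → ∀ n : S2, y + r • (n : E3) ∈ U := by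
    intro r h0 hr n
    have : ‖y + r • (n : E3) - y‖ = r := by
      rw [add_sub_cancel_left, norm_smul, norm_eq_of_mem_sphere, mul_one, Real.norm_of_nonneg h0.le]
    exact hyU _ (by rw [this]; exact h0) (by rw [this]; exact hr)
  have hev : ∀ g : E3 → ℝ, ContDiffOn ℝ (⊤ : ℕ∞) g U →
      ∀ᶠ r in 𝓝[>] (0:ℝ), Continuous (fun n : S2 => g (y + r • (n : E3))) := by
    intro g hg
    filter_upwards [Ioo_mem_nhdsGT hρ] with r hr
    exact pf_slice_continuous y r (hyU' r hr.1 hr.2) g hg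
  simp only [pf_finsum_eq y (pfLap F) cΔ hcΔ]
  exact pf_radial ρ hρ (fun r => ∫ n : S2, F (y + r • (n : E3)) ∂dOmega) (pfH y F) (pfL y F)
    (fun r h0 hr => pf_m_deriv hU y ρ hyU' F hF r h0 hr)
    (fun r h0 hr => pf_ode hU hF hdec hint y ρ hyU r h0 hr)
    _ _ (fun a => ∫ n : S2, c a n ∂dOmega) (fun a => ∫ n : S2, cΔ a n ∂dOmega)
    (fun a ha hn => pf_coeff_zero y F c hc a ha hn)
    (fun a ha hn => pf_coeff_zero y (pfLap F) cΔ hcΔ a ha hn)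
    (pf_exp_mean y F c hc (hev F hF))
    (pf_exp_mean y (pfLap F) cΔ hcΔ (hev _ (pf_lap_contDiffOn hU hF))) s₁

/-- partie finie of the integral of a Laplacian:
`Pf_{s₁,s₂} ∫ ΔF d³x = 4π(r₁F)₁ + 4π(r₂F)₂ = ∫ f₋₁ dΩ + ∫ g₋₁ dΩ`. -/
theorem pf_integral_of_laplacian
    (y₁ y₂ : E3) (hy : y₁ ≠ y₂) (s₁ s₂ : ℝ) (hs₁ : 0 < s₁) (hs₂ : 0 < s₂)
    (F : E3 → ℝ) (c d : ℝ → S2 → ℝ) (hF : MemF y₁ y₂ F c d)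
    (hci : IntegerExponents c) (hdi : IntegerExponents d)
    -- all first and second partial derivatives admit expansions at both points
    (h1 : ∀ i : Fin 3, (∃ e, HasSingExpansion y₁ (pder i F) e)
        ∧ ∃ e, HasSingExpansion y₂ (pder i F) e)
    (h2 : ∀ i j : Fin 3, (∃ e, HasSingExpansion y₁ (pder i (pder j F)) e)
        ∧ ∃ e, HasSingExpansion y₂ (pder i (pder j F)) e)
    -- expansions of the Laplacian ΔF at both points
    (cΔ dΔ : ℝ → S2 → ℝ)
    (hcΔ : HasSingExpansion y₁ (fun x => ∑ i : Fin 3, pder i (pder i F) x) cΔ)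
    (hdΔ : HasSingExpansion y₂ (fun x => ∑ i : Fin 3, pder i (pder i F) x) dΔ)
    -- decay at infinity: F = o(|x|⁻¹), ∇F = o(|x|⁻²), ΔF integrable near infinity
    (hdecF : Tendsto (fun x : E3 => ‖x‖ * F x) (cocompact E3) (𝓝 0))
    (hdecdF : ∀ i : Fin 3, Tendsto (fun x : E3 => ‖x‖ ^ 2 * pder i F x) (cocompact E3) (𝓝 0))
    (hint : ∃ R : ℝ, IntegrableOn (fun x => ∑ i : Fin 3, pder i (pder i F) x)
        (Metric.closedBall 0 R)ᶜ volume) :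
    HasPfIntegral y₁ y₂ s₁ s₂ (fun x => ∑ i : Fin 3, pder i (pder i F) x) cΔ dΔ
      ((∫ n : S2, c (-1) n ∂dOmega) + ∫ n : S2, d (-1) n ∂dOmega) := by
  have hU : IsOpen ({y₁, y₂}ᶜ : Set E3) := (Set.toFinite {y₁, y₂}).isClosed.isOpen_compl
  have hn : 0 < ‖y₁ - y₂‖ := norm_pos_iff.2 (sub_ne_zero.2 hy)
  set ρ : ℝ := ‖y₁ - y₂‖ / 2 with hρdef
  have hρ : 0 < ρ := by positivity
  have hy1 : ∀ x, 0 < ‖x - y₁‖ → ‖x - y₁‖ < ρ → x ∈ ({y₁, y₂}ᶜ : Set E3) := by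
    intro x h0 h1 hx
    rcases hx with rfl | hx
    · simp at h0
    · rw [Set.mem_singleton_iff] at hx
      subst hx
      rw [norm_sub_rev] at h1
      linarith
  have hy2 : ∀ x, 0 < ‖x - y₂‖ → ‖x - y₂‖ < ρ → x ∈ ({y₁, y₂}ᶜ : Set E3) := by
    intro x h0 h1 hx
    rcases hx with rfl | hx
    · linarith
    · rw [Set.mem_singleton_iff] at hx
      subst hx
      simp at h0
  have t1 := pf_point_limit hU hF.smooth hdecdF hint y₁ ρ hρ hy1 c cΔ hF.exp₁ hcΔ s₁
  have t2 := pf_point_limit hU hF.smooth hdecdF hint y₂ ρ hρ hy2 d dΔ hF.exp₂ hdΔ s₂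
  refine (t1.add t2).congr' ?_
  filter_upwards [Ioo_mem_nhdsGT (show 0 < ρ / 3 by positivity)] with s hs
  have := pf_total hy hF.smooth hdecdF hint ρ hρ (by rw [hρdef]; linarith) hy1 hy2 s hs.1 hs.2
  simp only [pfLap] at this
  unfold pfApprox
  rw [this]
  ring

end
end

section
/- (Partie finie by angular then radial integration.) Let F ∈ 𝓕 with integer exponents and F = O(|x|^{−3−η}) at infinity for some η > 0, and suppose Pf_{s₁,s₂} ∫ F d³x exists. Define the regularized function F̃₂ := F − Σ_{b ≤ −3} r₂^b g_b(n₂) (a finite sum) and its angular average Ã(r) := (1/4π) ∫_{S²} F̃₂(y₁ + r n) dΩ(n) for r > 0. Then r ↦ r²Ã(r) + (1/r)(r₂³F)₂ is integrable on (r₁₂, ∞), the radial partie finie Pf_{s₁} ∫₀^{r₁₂} r² Ã(r) dr := lim_{s→0⁺} [ ∫_s^{r₁₂} r² Ã(r) dr + Σ_{a<−3} (s^{a+3}/(a+3)) (1/4π)∫_{S²} f_a dΩ + ln(s/s₁) (1/4π)∫_{S²} f_{−3} dΩ ] exists, and Pf_{s₁,s₂} ∫ F d³x = 4π Pf_{s₁}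 ∫₀^{r₁₂} r² Ã(r) dr + 4π ∫_{r₁₂}^{∞} [ r² Ã(r) + (1/r)(r₂³F)₂ ] dr + 4π (r₂³F)₂ ln(r₁₂/s₂), where (r₂³F)₂ = (1/4π)∫_{S²} g_{−3} dΩ. -/
open MeasureTheory Filter Topology Real Asymptotics

noncomputable section

/-- A fixed base point of the unit sphere. -/
def basePt : S2 :=
  ⟨EuclideanSpace.single (0 : Fin 3) (1 : ℝ), by
    rw [mem_sphere_zero_iff_norm, EuclideanSpace.norm_single]; norm_num⟩

/-- The unit direction `(x − y)/|x − y| ∈ S²` (junk value when `x = y`). -/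
def dir (y x : E3) : S2 :=
  haveI := Classical.dec (x = y)
  if h : x = y then basePt
  else
    ⟨‖x - y‖⁻¹ • (x - y), by
      rw [mem_sphere_zero_iff_norm, norm_smul, norm_inv, norm_norm,
        inv_mul_cancel₀ (norm_ne_zero_iff.mpr (sub_ne_zero.mpr h))]⟩

instance : IsFiniteMeasure dOmega := by unfold dOmega; infer_instance

lemma dir_smul (r : ℝ) (hr : 0 < r) (n : S2) (y : E3) : dir y (y + r • (n : E3)) = n := by
  have hn : ‖(n : E3)‖ = 1 := by simp
  have h0 : (n : E3) ≠ 0 := by intro h; rw [h] at hn; simp at hn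
  have h : y + r • (n : E3) ≠ y := by
    simp [hr.ne', h0]
  unfold dir
  rw [dif_neg h]
  ext1
  simp [norm_smul, hn, abs_of_pos hr, smul_smul, hr.ne']

lemma dir_sub (y x : E3) : dir y x = dir 0 (x - y) := by
  unfold dir
  by_cases h : x = y
  · simp [h]
  · have h' : x - y ≠ 0 := sub_ne_zero.mpr h
    simp [h, h']

lemma dir_smul0 (r : ℝ) (hr : 0 < r) (n : S2) : dir 0 (r • (n : E3)) = n := by
  have := dir_smul r hr n 0
  simpa using this

lemma norm_smulS (r : ℝ) (hr : 0 < r) (n : S2) : ‖r • (n : E3)‖ = r := by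
  have hn : ‖(n : E3)‖ = 1 := by simp
  simp [norm_smul, hn, abs_of_pos hr]

lemma polar_mp : MeasurePreserving (homeomorphUnitSphereProd E3)
    ((volume : Measure E3).comap (↑)) (dOmega.prod (Measure.volumeIoiPow 2)) := by
  have := (volume : Measure E3).measurePreserving_homeomorphUnitSphereProd
  simpa [dOmega] using this

lemma polar_smul (x : ({0}ᶜ : Set E3)) :
    ((homeomorphUnitSphereProd E3 x).2 : ℝ) • ((homeomorphUnitSphereProd E3 x).1 : E3) = x := by
  have h : ‖(x : E3)‖ ≠ 0 := norm_ne_zero_iff.mpr x.2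
  simp [smul_smul, h]

lemma polar_iff (f : E3 → ℝ) : Integrable f volume ↔
    Integrable (fun p : S2 × Set.Ioi (0:ℝ) => f ((p.2 : ℝ) • (p.1 : E3)))
      (dOmega.prod (Measure.volumeIoiPow 2)) := by
  have := polar_mp.integrable_comp_emb (g := fun p : S2 × Set.Ioi (0:ℝ) => f ((p.2 : ℝ) • (p.1 : E3)))
    (Homeomorph.measurableEmbedding _)
  rw [← this]
  have e : ((fun p : S2 × Set.Ioi (0:ℝ) => f ((p.2 : ℝ) • (p.1 : E3))) ∘
    (homeomorphUnitSphereProd E3)) = f ∘ Subtype.val := by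
    funext x; simp only [Function.comp]; rw [polar_smul]
  rw [e]
  have h2 : volume.restrict ({0}ᶜ : Set E3) = volume := restrict_compl_singleton 0
  conv_lhs => rw [← h2]
  rw [← IntegrableOn, integrableOn_iff_comap_subtypeVal (measurableSet_singleton _).compl]

lemma polar_int (f : E3 → ℝ) : ∫ x, f x =
    ∫ p : S2 × Set.Ioi (0:ℝ), f ((p.2 : ℝ) • (p.1 : E3)) ∂(dOmega.prod (Measure.volumeIoiPow 2)) := by
  have := polar_mp.integral_comp (Homeomorph.measurableEmbedding _)
    (fun p : S2 × Set.Ioi (0:ℝ) => f ((p.2 : ℝ) • (p.1 : E3)))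
  rw [← this]
  simp_rw [polar_smul]
  rw [integral_subtype_comap (measurableSet_singleton _).compl f, restrict_compl_singleton]

lemma ioi_iff (w : ℝ → ℝ) : Integrable (fun r : Set.Ioi (0:ℝ) => w r) (Measure.volumeIoiPow 2) ↔
    IntegrableOn (fun r => r ^ 2 * w r) (Set.Ioi 0) := by
  rw [integrableOn_iff_comap_subtypeVal measurableSet_Ioi, Measure.volumeIoiPow,
    integrable_withDensity_iff_integrable_smul']
  · apply integrable_congr
    refine .of_forall ?_
    rintro ⟨x, hx : 0 < x⟩
    simp (disch := positivity) [ENNReal.toReal_ofReal]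
  · fun_prop
  · simp

lemma ioi_int (w : ℝ → ℝ) : ∫ r : Set.Ioi (0:ℝ), w r ∂(Measure.volumeIoiPow 2) =
    ∫ r in Set.Ioi (0:ℝ), r ^ 2 * w r := by
  simp only [Measure.volumeIoiPow, ENNReal.ofReal]
  rw [integral_withDensity_eq_integral_smul, 
        integral_subtype_comap measurableSet_Ioi fun a ↦ Real.toNNReal (a ^ 2) • w a,
        setIntegral_congr_fun measurableSet_Ioi fun x hx ↦ ?_]
  · rw [NNReal.smul_def, Real.coe_toNNReal _ (pow_nonneg hx.out.le _)]; rfl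
  · exact (measurable_subtype_coe.pow_const _).real_toNNReal

lemma polar_slice (f : E3 → ℝ) (hf : Integrable f) :
    IntegrableOn (fun r : ℝ => r ^ 2 * ∫ n : S2, f (r • (n : E3)) ∂dOmega) (Set.Ioi 0) ∧
    ∫ x, f x = ∫ r in Set.Ioi (0:ℝ), r ^ 2 * ∫ n : S2, f (r • (n : E3)) ∂dOmega ∧
    ∀ᵐ r ∂(volume.restrict (Set.Ioi (0:ℝ))), Integrable (fun n : S2 => f (r • (n : E3))) dOmega := by
  have h := (polar_iff f).1 hf
  refine ⟨?_, ?_, ?_⟩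
  · rw [← ioi_iff (fun r => ∫ n : S2, f (r • (n : E3)) ∂dOmega)]
    exact h.integral_prod_right
  · rw [polar_int, ← ioi_int (fun r => ∫ n : S2, f (r • (n : E3)) ∂dOmega),
      integral_prod_symm _ h]
  · have h1 := h.prod_left_ae
    rw [Measure.volumeIoiPow, ae_withDensity_iff (by fun_prop)] at h1
    rw [← map_comap_subtype_coe measurableSet_Ioi,
      (MeasurableEmbedding.subtype_coe measurableSet_Ioi).ae_map_iff]
    filter_upwards [h1] with r hr
    apply hr
    have := r.2.out
    simp only [ne_eq, ENNReal.ofReal_eq_zero, not_le]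
    positivity

lemma polar_prod (w : ℝ → ℝ) (g : S2 → ℝ) (hw : IntegrableOn (fun r => r ^ 2 * w r) (Set.Ioi 0))
    (hg : Integrable g dOmega) :
    Integrable (fun z : E3 => w ‖z‖ * g (dir 0 z)) ∧
    ∫ z : E3, w ‖z‖ * g (dir 0 z) = (∫ r in Set.Ioi (0:ℝ), r ^ 2 * w r) * ∫ n, g n ∂dOmega := by
  have e : (fun p : S2 × Set.Ioi (0:ℝ) => w ‖(p.2 : ℝ) • (p.1 : E3)‖ * g (dir 0 ((p.2 : ℝ) • (p.1 : E3))))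
    = fun p => g p.1 * w p.2 := by
    funext p
    rw [norm_smulS _ p.2.2, dir_smul0 _ p.2.2, mul_comm]
  constructor
  · rw [polar_iff, e]
    exact hg.mul_prod ((ioi_iff w).2 hw)
  · rw [polar_int]
    simp only [e]
    rw [integral_prod_mul g (fun r : Set.Ioi (0:ℝ) => w r), ioi_int, mul_comm]


lemma SmoothSphereFn.cont {g : S2 → ℝ} (hg : SmoothSphereFn g) : Continuous g := by
  obtain ⟨f, hf, h⟩ := hg
  have : g = fun n : S2 => f n := by funext n; rw [h]
  rw [this]
  exact hf.continuous.comp continuous_subtype_val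

lemma SmoothSphereFn.bdd {g : S2 → ℝ} (hg : SmoothSphereFn g) : ∃ B, 0 ≤ B ∧ ∀ n, |g n| ≤ B := by
  obtain ⟨B, hB⟩ := isCompact_univ.exists_bound_of_continuousOn (f := g) hg.cont.continuousOn
  refine ⟨B, (abs_nonneg _).trans (hB basePt trivial), fun n => hB n trivial⟩

lemma SmoothSphereFn.integ {g : S2 → ℝ} (hg : SmoothSphereFn g) : Integrable g dOmega := by
  obtain ⟨B, -, hB⟩ := hg.bdd
  exact Integrable.of_bound hg.cont.aestronglyMeasurable B (ae_of_all _ hB)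

lemma SmoothSphereFn.lip {g : S2 → ℝ} (hg : SmoothSphereFn g) :
    ∃ K, 0 ≤ K ∧ ∀ n m : S2, |g n - g m| ≤ K * ‖(n : E3) - m‖ := by
  obtain ⟨f, hf, h⟩ := hg
  obtain ⟨K, hK⟩ := ContDiffOn.exists_lipschitzOnWith (n := (⊤ : ℕ∞)) (s := Metric.closedBall (0 : E3) 1)
    hf.contDiffOn (by simp) (convex_closedBall _ _) (isCompact_closedBall _ _)
  refine ⟨K, K.2, fun n m => ?_⟩
  rw [← h, ← h]
  have := hK.dist_le_mul n (by simp) m (by simp)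
  rwa [Real.dist_eq, dist_eq_norm] at this

lemma dir_meas : Measurable (dir 0) := by
  apply (MeasurableEmbedding.subtype_coe (Metric.isClosed_sphere.measurableSet)).measurable_comp_iff.1
  classical
  have : (Subtype.val ∘ dir 0) = fun x : E3 => if x = 0 then (basePt : E3) else ‖x‖⁻¹ • x := by
    funext x
    simp only [Function.comp, dir]
    by_cases h : x = 0 <;> simp [h]
  rw [this]
  refine Measurable.ite (measurableSet_singleton (0 : E3)) measurable_const (by fun_prop)

lemma dir_coe {z : E3} (hz : z ≠ 0) : (dir 0 z : E3) = ‖z‖⁻¹ • z := by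
  simp [dir, hz]

/-- Radial sets. -/
lemma radial0 (b : ℝ) (g : S2 → ℝ) (hg : Integrable g dOmega) (S : Set ℝ) (hS : MeasurableSet S)
    (hS0 : S ⊆ Set.Ioi 0) (h : IntegrableOn (fun r : ℝ => r ^ (b + 2)) S) :
    IntegrableOn (fun x : E3 => ‖x‖ ^ b * g (dir 0 x)) {x | ‖x‖ ∈ S} ∧
    ∫ x in {x : E3 | ‖x‖ ∈ S}, ‖x‖ ^ b * g (dir 0 x) = (∫ r in S, r ^ (b + 2)) * ∫ n, g n ∂dOmega := by
  have hSm : MeasurableSet {x : E3 | ‖x‖ ∈ S} := measurable_norm hS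
  have e1 : ∀ r : ℝ, r ^ 2 * S.indicator (fun r => r ^ b) r = S.indicator (fun r : ℝ => r ^ (b + 2)) r := by
    intro r
    by_cases hr : r ∈ S
    · have : 0 < r := hS0 hr
      simp only [hr, Set.indicator_of_mem]
      rw [rpow_add this, mul_comm]; norm_num
    · simp [hr]
  have e2 : (fun x : E3 => S.indicator (fun r => r ^ b) ‖x‖ * g (dir 0 x)) =
      {x : E3 | ‖x‖ ∈ S}.indicator (fun x : E3 => ‖x‖ ^ b * g (dir 0 x)) := by
    funext x
    by_cases hx : ‖x‖ ∈ S <;> simp [hx]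
  have hi : IntegrableOn (fun r => r ^ 2 * S.indicator (fun r => r ^ b) r) (Set.Ioi (0:ℝ)) := by
    simp_rw [e1]
    exact ((integrable_indicator_iff hS).2 h).integrableOn
  obtain ⟨h1, h2⟩ := polar_prod (S.indicator (fun r => r ^ b)) g hi hg
  rw [e2] at h1
  refine ⟨(integrable_indicator_iff hSm).1 h1, ?_⟩
  rw [← integral_indicator hSm, ← e2, h2]
  simp_rw [e1]
  rw [setIntegral_indicator hS, Set.inter_eq_self_of_subset_right hS0]

lemma radial (y : E3) (b : ℝ) (g : S2 → ℝ) (hg : Integrable g dOmega) (S : Set ℝ) (hS : MeasurableSet S)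
    (hS0 : S ⊆ Set.Ioi 0) (h : IntegrableOn (fun r : ℝ => r ^ (b + 2)) S) :
    IntegrableOn (fun x : E3 => ‖x - y‖ ^ b * g (dir y x)) {x | ‖x - y‖ ∈ S} ∧
    ∫ x in {x : E3 | ‖x - y‖ ∈ S}, ‖x - y‖ ^ b * g (dir y x) =
      (∫ r in S, r ^ (b + 2)) * ∫ n, g n ∂dOmega := by
  obtain ⟨h1, h2⟩ := radial0 b g hg S hS hS0 h
  have hSm : MeasurableSet {x : E3 | ‖x‖ ∈ S} := measurable_norm hS
  have hSm' : MeasurableSet {x : E3 | ‖x - y‖ ∈ S} := by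
    have : Measurable (fun x : E3 => ‖x - y‖) := by fun_prop
    exact this hS
  have e : ∀ x, {x : E3 | ‖x - y‖ ∈ S}.indicator (fun x : E3 => ‖x - y‖ ^ b * g (dir y x)) x =
     {x : E3 | ‖x‖ ∈ S}.indicator (fun x : E3 => ‖x‖ ^ b * g (dir 0 x)) (x - y) := by
    intro x
    rw [Set.indicator, Set.indicator, dir_sub]; rfl
  constructor
  · rw [← integrable_indicator_iff hSm']
    simp_rw [funext e]
    exact ((integrable_indicator_iff hSm).2 h1).comp_sub_right y
  · rw [← h2, ← integral_indicator hSm', ← integral_indicator hSm]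
    simp_rw [e]
    rw [integral_sub_right_eq_self]

/-- exterior, b < -3 -/
lemma radial_ext (y : E3) (b : ℝ) (hb : b < -3) (g : S2 → ℝ) (hg : Integrable g dOmega) (s : ℝ)
    (hs : 0 < s) :
    IntegrableOn (fun x : E3 => ‖x - y‖ ^ b * g (dir y x)) (Metric.closedBall y s)ᶜ ∧
    ∫ x in (Metric.closedBall y s)ᶜ, ‖x - y‖ ^ b * g (dir y x) =
      - (s ^ (b + 3) / (b + 3) * ∫ n, g n ∂dOmega) := by
  have e : (Metric.closedBall y s)ᶜ = {x : E3 | ‖x - y‖ ∈ Set.Ioi s} := by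
    ext x; simp [dist_eq_norm]
  obtain ⟨h1, h2⟩ := radial y b g hg (Set.Ioi s) measurableSet_Ioi (Set.Ioi_subset_Ioi hs.le)
    (integrableOn_Ioi_rpow_of_lt (by linarith) hs)
  rw [e]
  refine ⟨h1, ?_⟩
  rw [h2, integral_Ioi_rpow_of_lt (by linarith) hs]
  rw [show b + 2 + 1 = b + 3 by ring]; ring

/-- interior, b > -3 -/
lemma radial_int (y : E3) (b : ℝ) (hb : -3 < b) (g : S2 → ℝ) (hg : Integrable g dOmega) (s : ℝ)
    (hs : 0 < s) :
    IntegrableOn (fun x : E3 => ‖x - y‖ ^ b * g (dir y x)) (Metric.ball y s) := by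
  obtain ⟨h1, h2⟩ := radial y b g hg (Set.Ioo 0 s) measurableSet_Ioo Set.Ioo_subset_Ioi_self
    ((intervalIntegral.integrableOn_Ioo_rpow_iff hs).2 (by linarith))
  apply h1.mono_set_ae
  have : ∀ᵐ x : E3, x ≠ y := by simp [ae_iff, measure_singleton]
  filter_upwards [this] with x hx hx2
  refine ⟨norm_pos_iff.2 (sub_ne_zero.2 hx), ?_⟩
  have h3 : x ∈ Metric.ball y s := hx2
  simpa [dist_eq_norm] using h3

/-- shell, b = -3 -/
lemma radial_shell (g : S2 → ℝ) (hg : Integrable g dOmega) (s ρ : ℝ)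
    (hs : 0 < s) (hρ : s ≤ ρ) :
    IntegrableOn (fun x : E3 => ‖x‖ ^ (-3 : ℝ) * g (dir 0 x)) {x | ‖x‖ ∈ Set.Ioc s ρ} ∧
    ∫ x in {x : E3 | ‖x‖ ∈ Set.Ioc s ρ}, ‖x‖ ^ (-3 : ℝ) * g (dir 0 x) =
      log (ρ / s) * ∫ n, g n ∂dOmega := by
  have hρ0 := hs.trans_le hρ
  have e : ∀ r : ℝ, r ^ (-3 + 2 : ℝ) = r⁻¹ := by
    intro r; norm_num [rpow_neg_one]
  have hi : IntegrableOn (fun r : ℝ => r⁻¹) (Set.Ioc s ρ) := by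
    rw [← intervalIntegrable_iff_integrableOn_Ioc_of_le hρ]
    apply intervalIntegral.intervalIntegrable_inv
    · intro x hx
      rw [Set.uIcc_of_le hρ] at hx
      exact (hs.trans_le hx.1).ne'
    · exact continuousOn_id
  obtain ⟨h1, h2⟩ := radial0 (-3) g hg (Set.Ioc s ρ) measurableSet_Ioc
    (fun x hx => hs.trans hx.1) (by simp_rw [e]; exact hi)
  refine ⟨h1, ?_⟩
  rw [h2]
  simp_rw [e]
  rw [← intervalIntegral.integral_of_le hρ, integral_inv_of_pos hs hρ0]


/-- The exterior part of `|z|^(-3) g(z/|z|)`. -/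
def tail (g : S2 → ℝ) (s : ℝ) : E3 → ℝ :=
  {z : E3 | s < ‖z‖}.indicator (fun z => ‖z‖ ^ (-3 : ℝ) * g (dir 0 z))

lemma tail_set_meas (s : ℝ) : MeasurableSet {z : E3 | s < ‖z‖} :=
  measurableSet_lt measurable_const measurable_norm

lemma tail_meas {g : S2 → ℝ} (hg : SmoothSphereFn g) (s : ℝ) : Measurable (tail g s) := by
  apply Measurable.indicator _ (tail_set_meas s)
  have := hg.cont.measurable.comp dir_meas
  apply Measurable.mul _ this
  fun_prop

lemma tail_le {g : S2 → ℝ} {B : ℝ} (hB0 : 0 ≤ B) (hB : ∀ n, |g n| ≤ B) {s : ℝ} (hs : 0 < s) (z : E3) :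
    |tail g s z| ≤ B * s ^ (-3 : ℝ) := by
  by_cases hz : s < ‖z‖
  · rw [tail, Set.indicator_of_mem (by exact hz), abs_mul, abs_of_nonneg (by positivity), mul_comm]
    exact mul_le_mul (hB _) (rpow_le_rpow_of_nonpos hs hz.le (by norm_num)) (by positivity) hB0
  · rw [tail, Set.indicator_of_notMem (by exact hz)]
    simp; positivity

lemma tail_le2 {g : S2 → ℝ} {B : ℝ} (_hB0 : 0 ≤ B) (hB : ∀ n, |g n| ≤ B) {s : ℝ} (z : E3) :
    |tail g s z| ≤ {z : E3 | s < ‖z‖}.indicator (fun z => B * ‖z‖ ^ (-3 : ℝ)) z := by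
  by_cases hz : s < ‖z‖
  · rw [tail, Set.indicator_of_mem (by exact hz), Set.indicator_of_mem (by exact hz), abs_mul, abs_of_nonneg (by positivity), mul_comm]
    gcongr
    exact hB _
  · rw [tail, Set.indicator_of_notMem (by exact hz), Set.indicator_of_notMem (by exact hz)]
    simp

lemma int4 (s : ℝ) (hs : 0 < s) : Integrable ({z : E3 | s < ‖z‖}.indicator (fun z => ‖z‖ ^ (-4 : ℝ))) := by
  rw [integrable_indicator_iff (tail_set_meas s)]
  have := (radial_ext 0 (-4) (by norm_num) (fun _ => 1) (integrable_const _) s hs).1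
  have e : (Metric.closedBall (0:E3) s)ᶜ = {z : E3 | s < ‖z‖} := by ext; simp
  rw [e] at this
  simpa using this

lemma dir_diff {z w : E3} (hz : z ≠ 0) (hw : w ≠ 0) :
    ‖(dir 0 z : E3) - dir 0 w‖ ≤ 2 * ‖z - w‖ / ‖z‖ := by
  rw [dir_coe hz, dir_coe hw]
  have hz' : 0 < ‖z‖ := norm_pos_iff.2 hz
  have hw' : 0 < ‖w‖ := norm_pos_iff.2 hw
  have : ‖z‖⁻¹ • z - ‖w‖⁻¹ • w = ‖z‖⁻¹ • (z - w) + (‖z‖⁻¹ - ‖w‖⁻¹) • w := by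
    rw [smul_sub, sub_smul]; abel
  rw [this]
  have h1 : ‖‖z‖⁻¹ • (z - w)‖ = ‖z - w‖ / ‖z‖ := by
    rw [norm_smul, norm_inv, norm_norm]; field_simp
  have h2 : ‖(‖z‖⁻¹ - ‖w‖⁻¹) • w‖ ≤ ‖z - w‖ / ‖z‖ := by
    rw [norm_smul, Real.norm_eq_abs, inv_sub_inv hz'.ne' hw'.ne', abs_div, abs_mul,
      abs_of_pos hz', abs_of_pos hw']
    have : |‖w‖ - ‖z‖| ≤ ‖z - w‖ := by
      rw [abs_sub_comm]; exact abs_norm_sub_norm_le z w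
    calc |‖w‖ - ‖z‖| / (‖z‖ * ‖w‖) * ‖w‖ = |‖w‖ - ‖z‖| / ‖z‖ := by field_simp
      _ ≤ _ := by gcongr
  calc _ ≤ _ := norm_add_le _ _
    _ ≤ ‖z - w‖ / ‖z‖ + ‖z - w‖ / ‖z‖ := by rw [h1]; gcongr
    _ = _ := by ring

lemma cube_diff {a b V : ℝ} (ha : 0 < a) (hb : a ≤ 2 * b) (hV : |a - b| ≤ V) :
    |a ^ (-3 : ℝ) - b ^ (-3 : ℝ)| ≤ 14 * V * a ^ (-4 : ℝ) := by
  have hb0 : 0 < b := by linarith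
  have e : ∀ t : ℝ, t ^ (-3 : ℝ) = (t⁻¹) ^ 3 := by
    intro t
    rw [show (-3 : ℝ) = ((-3 : ℤ) : ℝ) by norm_num, rpow_intCast]
    rw [zpow_neg, inv_pow]; rfl
  have e4 : ∀ t : ℝ, t ^ (-4 : ℝ) = (t⁻¹) ^ 4 := by
    intro t
    rw [show (-4 : ℝ) = ((-4 : ℤ) : ℝ) by norm_num, rpow_intCast]
    rw [zpow_neg, inv_pow]; rfl
  rw [e, e, e4]
  have hV0 : 0 ≤ V := (abs_nonneg _).trans hV
  set p := a⁻¹ with hp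
  set q := b⁻¹ with hq
  have hp0 : 0 < p := by positivity
  have hq0 : 0 < q := by positivity
  have hqp : q ≤ 2 * p := by
    rw [hp, hq, inv_le_iff_one_le_mul₀ hb0]
    field_simp
    linarith
  have h1 : p - q = (b - a) * (p * q) := by rw [hp, hq]; field_simp
  have h2 : p ^ 3 - q ^ 3 = (b - a) * (p * q * (p ^ 2 + p * q + q ^ 2)) := by
    have : p ^ 3 - q ^ 3 = (p - q) * (p ^ 2 + p * q + q ^ 2) := by ring
    rw [this, h1]; ring
  rw [h2, abs_mul, abs_sub_comm, abs_of_nonneg (by positivity : 0 ≤ p * q * (p ^ 2 + p * q + q ^ 2))]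
  calc |a - b| * (p * q * (p ^ 2 + p * q + q ^ 2))
      ≤ V * (p * (2 * p) * (p ^ 2 + p * (2 * p) + (2 * p) ^ 2)) := by gcongr
    _ = 14 * V * p ^ 4 := by ring

lemma tail_diff_integrable {g : S2 → ℝ} (hg : SmoothSphereFn g) {ρ : ℝ} (hρ : 0 < ρ) (v : E3) :
    Integrable (fun z => tail g ρ z - tail g ρ (z - v)) := by
  obtain ⟨B, hB0, hB⟩ := hg.bdd
  obtain ⟨K, hK0, hK⟩ := hg.lip
  have hm : Measurable (fun z => tail g ρ z - tail g ρ (z - v)) :=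
    (tail_meas hg ρ).sub ((tail_meas hg ρ).comp (by fun_prop))
  set M := 2 * ‖v‖ + 2 * ρ with hM
  have hM0 : 0 < M := by positivity
  rw [← integrableOn_univ, ← Set.union_compl_self (Metric.closedBall (0:E3) M)]
  apply IntegrableOn.union
  · apply Measure.integrableOn_of_bounded (M := 2 * (B * ρ ^ (-3 : ℝ)))
      measure_closedBall_lt_top.ne hm.aestronglyMeasurable
    refine ae_of_all _ fun z => ?_
    calc _ ≤ |tail g ρ z| + |tail g ρ (z - v)| := abs_sub _ _
      _ ≤ _ := by linarith [tail_le hB0 hB hρ z, tail_le hB0 hB hρ (z - v)]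
  · have h4 := ((int4 M hM0).const_mul (2 * K * ‖v‖ + 14 * B * ‖v‖)).integrableOn (s := (Metric.closedBall (0:E3) M)ᶜ)
    refine h4.mono' hm.aestronglyMeasurable ?_
    refine (ae_restrict_iff' Metric.isClosed_closedBall.measurableSet.compl).2 (ae_of_all _ fun z hz => ?_)
    have hz : M < ‖z‖ := by simpa using hz
    have hv : ‖z‖ - ‖v‖ ≤ ‖z - v‖ := norm_sub_norm_le z v
    have hz1 : ρ < ‖z‖ := by linarith [norm_nonneg v]
    have hz2 : ρ < ‖z - v‖ := by linarith [norm_nonneg v]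
    have hz0 : z ≠ 0 := norm_pos_iff.1 (by linarith)
    have hw0 : z - v ≠ 0 := norm_pos_iff.1 (by linarith)
    rw [Set.indicator_of_mem (by exact hz), tail, Set.indicator_of_mem (by exact hz1),
      Set.indicator_of_mem (by exact hz2), Real.norm_eq_abs]
    have hc := cube_diff (a := ‖z‖) (b := ‖z - v‖) (V := ‖v‖) (by linarith) (by linarith) (by
      simpa using abs_norm_sub_norm_le z (z - v))
    have hd := dir_diff hz0 hw0
    rw [sub_sub_cancel] at hd
    have hk := hK (dir 0 z) (dir 0 (z - v))
    have e43 : ‖z‖ ^ (-4 : ℝ) = ‖z‖ ^ (-3 : ℝ) / ‖z‖ := by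
      rw [show (-4 : ℝ) = -3 - 1 by norm_num, rpow_sub (by linarith), rpow_one]
    calc |‖z‖ ^ (-3 : ℝ) * g (dir 0 z) - ‖z - v‖ ^ (-3 : ℝ) * g (dir 0 (z - v))|
        = |‖z‖ ^ (-3 : ℝ) * (g (dir 0 z) - g (dir 0 (z - v))) +
          (‖z‖ ^ (-3 : ℝ) - ‖z - v‖ ^ (-3 : ℝ)) * g (dir 0 (z - v))| := by congr 1; ring
      _ ≤ ‖z‖ ^ (-3 : ℝ) * (K * (2 * ‖v‖ / ‖z‖)) + (14 * ‖v‖ * ‖z‖ ^ (-4 : ℝ)) * B := by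
        refine (abs_add_le _ _).trans ?_
        rw [abs_mul, abs_mul, abs_of_nonneg (by positivity : 0 ≤ ‖z‖ ^ (-3 : ℝ))]
        gcongr
        · exact hk.trans (by gcongr)
        · exact hB _
      _ = _ := by rw [e43]; ring

lemma chi_diff {R a b : ℝ} (hR : 0 < R) (ha : 0 ≤ a) (hb : 0 < b) :
    |R / (R + a) - R / (R + b)| ≤ |a - b| / b := by
  have : R / (R + a) - R / (R + b) = (b - a) * (R / (R + a)) / (R + b) := by field_simp; ring
  rw [this, abs_div, abs_mul, abs_sub_comm, abs_of_nonneg (by positivity : 0 ≤ R / (R + a)),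
    abs_of_pos (by positivity : 0 < R + b)]
  have h1 : R / (R + a) ≤ 1 := by rw [div_le_one (by positivity)]; linarith
  calc |a - b| * (R / (R + a)) / (R + b) ≤ |a - b| * 1 / b := by
        gcongr; linarith
    _ = _ := by ring

lemma tail_diff_integral {g : S2 → ℝ} (hg : SmoothSphereFn g) {ρ : ℝ} (hρ : 0 < ρ) (v : E3) :
    ∫ z, (tail g ρ z - tail g ρ (z - v)) = 0 := by
  obtain ⟨B, hB0, hB⟩ := hg.bdd
  set φ := tail g ρ with hφ
  have hφm : Measurable φ := tail_meas hg ρ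
  let f : ℕ → E3 → ℝ := fun N z => ((N:ℝ) + 1) / ((N:ℝ) + 1 + ‖z‖) * φ z
  have hfm : ∀ N, Measurable (f N) := fun N => by
    apply Measurable.mul _ hφm
    fun_prop
  have e43 : ∀ z : E3, ρ < ‖z‖ → ‖z‖ ^ (-4 : ℝ) = ‖z‖ ^ (-3 : ℝ) / ‖z‖ := by
    intro z hz
    rw [show (-4 : ℝ) = -3 - 1 by norm_num, rpow_sub (by linarith), rpow_one]
  have hfi : ∀ N, Integrable (f N) := by
    intro N
    refine ((int4 ρ hρ).const_mul (((N:ℝ) + 1) * B)).mono' (hfm N).aestronglyMeasurable (ae_of_all _ fun z => ?_)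
    have := tail_le2 hB0 hB (s := ρ) z
    by_cases hz : ρ < ‖z‖
    · have hz0 : 0 < ‖z‖ := by linarith
      rw [Set.indicator_of_mem (by exact hz)] at this ⊢
      rw [Real.norm_eq_abs, abs_mul, abs_of_nonneg (by positivity), e43 z hz]
      calc _ ≤ ((N:ℝ) + 1) / ‖z‖ * (B * ‖z‖ ^ (-3 : ℝ)) := by
            gcongr
            linarith
        _ = _ := by ring
    · rw [Set.indicator_of_notMem (by exact hz)]
      simp [f, hφ, tail, hz]
  have hz : ∀ N, ∫ z, (f N z - f N (z - v)) = 0 := by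
    intro N
    rw [integral_sub (hfi N) ((hfi N).comp_sub_right v), integral_sub_right_eq_self, sub_self]
  have hlim : Tendsto (fun N => ∫ z, (f N z - f N (z - v))) atTop
      (𝓝 (∫ z, (φ z - φ (z - v)))) := by
    apply tendsto_integral_of_dominated_convergence
      (fun z => |φ z - φ (z - v)| + B * ‖v‖ * {z : E3 | ρ < ‖z‖}.indicator (fun z => ‖z‖ ^ (-4 : ℝ)) (z - v))
    · intro N
      exact ((hfm N).sub ((hfm N).comp (by fun_prop))).aestronglyMeasurable
    · exact (tail_diff_integrable hg hρ v).abs.add (((int4 ρ hρ).comp_sub_right v).const_mul _)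
    · intro N
      refine ae_of_all _ fun z => ?_
      have hR : (0:ℝ) < (N:ℝ) + 1 := by positivity
      have e : f N z - f N (z - v) = ((N:ℝ) + 1) / ((N:ℝ) + 1 + ‖z‖) * (φ z - φ (z - v)) +
        (((N:ℝ) + 1) / ((N:ℝ) + 1 + ‖z‖) - ((N:ℝ) + 1) / ((N:ℝ) + 1 + ‖z - v‖)) * φ (z - v) := by
        simp only [f]; ring
      rw [Real.norm_eq_abs, e]
      refine (abs_add_le _ _).trans ?_
      apply add_le_add
      · rw [abs_mul, abs_of_nonneg (by positivity)]
        apply mul_le_of_le_one_left (abs_nonneg _)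
        rw [div_le_one (by positivity)]; linarith [norm_nonneg z]
      · by_cases hz : ρ < ‖z - v‖
        · have h1 := tail_le2 hB0 hB (s := ρ) (z - v)
          rw [Set.indicator_of_mem (by exact hz)] at h1 ⊢
          have h2 := chi_diff hR (norm_nonneg z) (hρ.trans hz)
          have h3 : |‖z‖ - ‖z - v‖| ≤ ‖v‖ := by simpa using abs_norm_sub_norm_le z (z - v)
          have h0 := hρ.trans hz
          rw [abs_mul, e43 _ hz]
          calc _ ≤ ‖v‖ / ‖z - v‖ * (B * ‖z - v‖ ^ (-3 : ℝ)) := by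
                gcongr
                exact h2.trans (by gcongr)
            _ = _ := by ring
        · have : φ (z - v) = 0 := by
            rw [hφ, tail, Set.indicator_of_notMem (by exact hz)]
          rw [this, Set.indicator_of_notMem (by exact hz)]; simp
    · refine ae_of_all _ fun z => ?_
      have hχ : ∀ a : ℝ, 0 ≤ a → Tendsto (fun N : ℕ => ((N:ℝ) + 1) / ((N:ℝ) + 1 + a)) atTop (𝓝 1) := by
        intro a ha
        have h1 : Tendsto (fun N : ℕ => 1 - a / ((N:ℝ) + 1 + a)) atTop (𝓝 (1 - 0)) := by
          apply tendsto_const_nhds.sub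
          apply tendsto_const_nhds.div_atTop
          apply tendsto_atTop_add_const_right
          apply tendsto_atTop_add_const_right
          exact tendsto_natCast_atTop_atTop
        rw [sub_zero] at h1
        refine h1.congr fun N => ?_
        field_simp
        ring
      simpa [f] using ((hχ _ (norm_nonneg z)).mul_const (φ z)).sub ((hχ _ (norm_nonneg (z - v))).mul_const (φ (z - v)))
  simp_rw [hz] at hlim
  exact (tendsto_nhds_unique hlim tendsto_const_nhds)

/-- The key comparison of two tails. -/
lemma tail_compare {g : S2 → ℝ} (hg : SmoothSphereFn g) {s ρ : ℝ} (hs : 0 < s) (hsρ : s ≤ ρ) (y₁ y₂ : E3) :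
    Integrable (fun x => tail g s (x - y₂) - tail g ρ (x - y₁)) ∧
    ∫ x, (tail g s (x - y₂) - tail g ρ (x - y₁)) = log (ρ / s) * ∫ n, g n ∂dOmega := by
  have hρ := hs.trans_le hsρ
  obtain ⟨h1, h2⟩ := radial_shell g hg.integ s ρ hs hsρ
  have hSm : MeasurableSet {x : E3 | ‖x‖ ∈ Set.Ioc s ρ} := measurable_norm measurableSet_Ioc
  have i1 := ((integrable_indicator_iff hSm).2 h1).comp_sub_right y₂
  have i2 := (tail_diff_integrable hg hρ (y₁ - y₂)).comp_sub_right y₂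
  have e : ∀ x, tail g s (x - y₂) - tail g ρ (x - y₁) =
    {x : E3 | ‖x‖ ∈ Set.Ioc s ρ}.indicator (fun x : E3 => ‖x‖ ^ (-3 : ℝ) * g (dir 0 x)) (x - y₂) +
    (tail g ρ (x - y₂) - tail g ρ (x - y₂ - (y₁ - y₂))) := by
    intro x
    rw [sub_sub_sub_cancel_right]
    suffices tail g s (x - y₂) = {x : E3 | ‖x‖ ∈ Set.Ioc s ρ}.indicator (fun x : E3 => ‖x‖ ^ (-3 : ℝ) * g (dir 0 x)) (x - y₂) +
      tail g ρ (x - y₂) by rw [this]; ring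
    generalize x - y₂ = z
    simp only [tail, Set.indicator, Set.mem_ofPred_eq, Set.mem_Ioc]
    by_cases ha : s < ‖z‖
    · by_cases hb : ρ < ‖z‖
      · simp [ha, hb]
      · simp [ha, hb, not_lt.1 hb]
    · have hb : ¬ ρ < ‖z‖ := by linarith
      simp [ha, hb]
  simp_rw [e]
  refine ⟨i1.add i2, ?_⟩
  rw [integral_add i1 i2,
    integral_sub_right_eq_self (fun x => {x : E3 | ‖x‖ ∈ Set.Ioc s ρ}.indicator (fun x : E3 => ‖x‖ ^ (-3 : ℝ) * g (dir 0 x)) x),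
    integral_sub_right_eq_self (fun x => tail g ρ x - tail g ρ (x - (y₁ - y₂))),
    tail_diff_integral hg hρ, integral_indicator hSm, h2, add_zero]


lemma fs_eq (P : ℝ → Prop) (T : Finset ℝ) (t : ℝ → ℝ) (h : ∀ b, t b ≠ 0 → (P b ↔ b ∈ T)) :
    ∑ᶠ (b : ℝ) (_ : P b), t b = ∑ b ∈ T, t b := by
  apply finsum_mem_eq_sum_of_inter_support_eq (s := {b | P b})
  ext b
  simp only [Set.mem_inter_iff, Function.mem_support, Finset.mem_coe]
  constructor
  · rintro ⟨h1, h2⟩; exact ⟨(h b h2).1 h1, h2⟩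
  · rintro ⟨h1, h2⟩; exact ⟨(h b h2).2 h1, h2⟩

lemma sum_split (d : ℝ → S2 → ℝ) (hd : ∀ N : ℝ, {a : ℝ | a ≤ N ∧ d a ≠ 0}.Finite) :
    ∃ T T2 : Finset ℝ, (∀ b ∈ T, b < -3) ∧ (∀ b ∈ T2, -3 < b) ∧
      ∀ t : ℝ → ℝ, (∀ b, d b = 0 → t b = 0) →
        (∑ᶠ (b : ℝ) (_ : b < -3), t b = ∑ b ∈ T, t b) ∧
        (∑ᶠ (b : ℝ) (_ : b ≤ -3), t b = ∑ b ∈ T, t b + t (-3)) ∧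
        (∑ᶠ (b : ℝ) (_ : b ≤ ((0 : ℕ) : ℝ)), t b = (∑ b ∈ T, t b + t (-3)) + ∑ b ∈ T2, t b) := by
  classical
  set T0 := (hd 0).toFinset with hT0
  have m0 : ∀ b, b ∈ T0 ↔ b ≤ 0 ∧ d b ≠ 0 := by intro b; simp [hT0]
  set T := T0.filter (· < -3) with hT
  set T2 := T0.filter (-3 < ·) with hT2
  have mT : ∀ b, b ∈ T ↔ b < -3 ∧ d b ≠ 0 := by
    intro b; rw [hT, Finset.mem_filter, m0]
    constructor
    · rintro ⟨⟨_, h⟩, h2⟩; exact ⟨h2, h⟩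
    · rintro ⟨h, h2⟩; exact ⟨⟨by linarith, h2⟩, h⟩
  have mT2 : ∀ b, b ∈ T2 ↔ -3 < b ∧ b ≤ 0 ∧ d b ≠ 0 := by
    intro b; rw [hT2, Finset.mem_filter, m0]; tauto
  have n3 : (-3 : ℝ) ∉ T := by rw [mT]; simp
  have dj : Disjoint (insert (-3 : ℝ) T) T2 := by
    rw [Finset.disjoint_left]
    intro b hb hb2
    rw [mT2] at hb2
    rcases Finset.mem_insert.1 hb with h | h
    · linarith
    · rw [mT] at h; linarith
  refine ⟨T, T2, fun b hb => ((mT b).1 hb).1, fun b hb => ((mT2 b).1 hb).1, fun t ht => ?_⟩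
  have ht' : ∀ b, t b ≠ 0 → d b ≠ 0 := fun b hb h => hb (ht b h)
  refine ⟨fs_eq _ _ _ fun b hb => ?_, ?_, ?_⟩
  · rw [mT]; simp [ht' b hb]
  · rw [add_comm, ← Finset.sum_insert n3]
    refine fs_eq _ _ _ fun b hb => ?_
    rw [Finset.mem_insert, mT, le_iff_lt_or_eq]; simp [ht' b hb, or_comm]
  · rw [add_comm (∑ b ∈ T, t b), ← Finset.sum_insert n3, ← Finset.sum_union dj]
    refine fs_eq _ _ _ fun b hb => ?_
    have hdb := ht' b hb
    rw [Finset.mem_union, Finset.mem_insert, mT, mT2, Nat.cast_zero]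
    constructor
    · intro h
      rcases lt_trichotomy b (-3) with h1 | h1 | h1
      · exact Or.inl (Or.inr ⟨h1, hdb⟩)
      · exact Or.inl (Or.inl h1)
      · exact Or.inr ⟨h1, h, hdb⟩
    · rintro ((h | h) | h)
      · rw [h]; norm_num
      · linarith [h.1]
      · exact h.2.1

lemma pt_eq {x y : E3} (h : x ≠ y) : x = y + ‖x - y‖ • (dir y x : E3) := by
  have h' : ‖x - y‖ ≠ 0 := norm_ne_zero_iff.2 (sub_ne_zero.2 h)
  rw [dir_sub, dir_coe (sub_ne_zero.2 h), smul_smul, mul_inv_cancel₀ h']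
  simp

lemma term_meas (y : E3) (b : ℝ) {g : S2 → ℝ} (hg : SmoothSphereFn g) :
    Measurable (fun x : E3 => ‖x - y‖ ^ b * g (dir y x)) := by
  simp_rw [dir_sub y]
  have h1 : Measurable (fun x : E3 => g (dir 0 (x - y))) :=
    hg.cont.measurable.comp (dir_meas.comp (by fun_prop))
  apply Measurable.mul _ h1
  fun_prop

lemma F_aesm {y₁ y₂ : E3} {F : E3 → ℝ} (hF : ContDiffOn ℝ (⊤ : ℕ∞) F ({y₁, y₂}ᶜ : Set E3)) :
    AEStronglyMeasurable F volume := by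
  have hm : MeasurableSet ({y₁, y₂}ᶜ : Set E3) := (Set.toFinite _).measurableSet.compl
  have := hF.continuousOn.aestronglyMeasurable (μ := volume) hm
  have e : volume.restrict ({y₁, y₂}ᶜ : Set E3) = volume := by
    apply Measure.restrict_eq_self_of_ae_mem
    exact (Set.toFinite ({y₁, y₂} : Set E3)).countable.ae_notMem volume
  rwa [e] at this

lemma F_int {y₁ y₂ : E3} {F : E3 → ℝ} (hF : ContDiffOn ℝ (⊤ : ℕ∞) F ({y₁, y₂}ᶜ : Set E3))
    {η : ℝ} (hη : 0 < η)
    (hdecay : ∃ C R : ℝ, ∀ x : E3, R ≤ ‖x‖ → |F x| ≤ C * ‖x‖ ^ (-3 - η)) {s : ℝ} (hs : 0 < s) :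
    IntegrableOn F (Metric.closedBall y₁ s ∪ Metric.closedBall y₂ s)ᶜ := by
  obtain ⟨C, R, hC⟩ := hdecay
  set M := max R 1 with hM
  have hM0 : 0 < M := lt_of_lt_of_le one_pos (le_max_right _ _)
  have hRM : R ≤ M := le_max_left _ _
  have h1 : IntegrableOn F (Metric.closedBall 0 M ∩ (Metric.ball y₁ s ∪ Metric.ball y₂ s)ᶜ) := by
    apply ContinuousOn.integrableOn_compact
    · exact (isCompact_closedBall _ _).inter_right
        (Metric.isOpen_ball.union Metric.isOpen_ball).isClosed_compl
    · apply hF.continuousOn.mono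
      rintro x ⟨-, hx⟩ hx2
      apply hx
      rcases hx2 with rfl | rfl
      · left; simpa using hs
      · right; simpa using hs
  have h2 : IntegrableOn F (Metric.closedBall 0 M)ᶜ := by
    have := (radial_ext 0 (-3 - η) (by linarith) (fun _ => 1) (integrable_const _) M hM0).1
    refine (this.const_mul C).mono' (F_aesm hF).restrict ?_
    refine (ae_restrict_iff' Metric.isClosed_closedBall.measurableSet.compl).2 (ae_of_all _ fun z hz => ?_)
    have hz : M < ‖z‖ := by simpa using hz
    simpa using hC z (by linarith)
  refine (h1.union h2).mono_set ?_
  intro x hx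
  by_cases h : x ∈ Metric.closedBall 0 M
  · left
    refine ⟨h, fun h' => hx ?_⟩
    exact Set.union_subset_union Metric.ball_subset_closedBall Metric.ball_subset_closedBall h'
  · right; exact h

lemma Ft_int {y₁ y₂ : E3} {F : E3 → ℝ} {d : ℝ → S2 → ℝ}
    (hF : ContDiffOn ℝ (⊤ : ℕ∞) F ({y₁, y₂}ᶜ : Set E3)) (hd : HasSingExpansion y₂ F d)
    {T T2 : Finset ℝ} (hT2 : ∀ b ∈ T2, -3 < b)
    (hs : ∀ t : ℝ → ℝ, (∀ b, d b = 0 → t b = 0) →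
      ∑ᶠ (b : ℝ) (_ : b ≤ ((0 : ℕ) : ℝ)), t b = (∑ b ∈ T, t b + t (-3)) + ∑ b ∈ T2, t b)
    {Ft : E3 → ℝ} (hFt : ∀ x, Ft x = F x - (∑ b ∈ T, ‖x - y₂‖ ^ b * d b (dir y₂ x) +
      ‖x - y₂‖ ^ (-3 : ℝ) * d (-3) (dir y₂ x))) :
    ∃ δ > 0, IntegrableOn Ft (Metric.ball y₂ δ) := by
  obtain ⟨δ, hδ, h⟩ := hd.expansion 0 1 one_pos
  refine ⟨δ, hδ, ?_⟩
  let P : E3 → ℝ := fun x => ∑ b ∈ T2, ‖x - y₂‖ ^ b * d b (dir y₂ x)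
  have hPm : Measurable P := Finset.measurable_fun_sum _ fun b _ => term_meas y₂ b (hd.smooth_coeffs b)
  have hP : IntegrableOn P (Metric.ball y₂ δ) :=
    integrable_finsetSum _ fun b hb => radial_int y₂ b (hT2 b hb) (d b) (hd.smooth_coeffs b).integ δ hδ
  have hFtm : AEStronglyMeasurable Ft volume := by
    rw [funext hFt]
    refine (F_aesm hF).sub (Measurable.aestronglyMeasurable ?_)
    exact (Finset.measurable_fun_sum _ fun b _ => term_meas y₂ b (hd.smooth_coeffs b)).add
      (term_meas y₂ _ (hd.smooth_coeffs _))
  have hQ : IntegrableOn (fun x => Ft x - P x) (Metric.ball y₂ δ) := by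
    apply Measure.integrableOn_of_bounded (M := 1) measure_ball_lt_top.ne
      (hFtm.sub hPm.aestronglyMeasurable)
    have hne : ∀ᵐ x : E3, x ≠ y₂ := by simp [ae_iff, measure_singleton]
    filter_upwards [ae_restrict_of_ae hne, ae_restrict_mem measurableSet_ball] with x hx hx2
    have h0 : 0 < ‖x - y₂‖ := norm_pos_iff.2 (sub_ne_zero.2 hx)
    have h1 := h ‖x - y₂‖ h0 (by simpa [dist_eq_norm] using hx2) (dir y₂ x)
    rw [← pt_eq hx, hs _ (by intro b hb; simp [hb])] at h1
    rw [Pi.sub_apply, hFt, Real.norm_eq_abs]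
    simp only [P]
    convert h1 using 2
    · ring
    · simp
  have := hQ.add hP
  refine this.congr (ae_of_all _ fun x => ?_)
  simp


lemma slice_ext (H : E3 → ℝ) (y : E3) (s : ℝ) (hs : 0 < s)
    (hH : IntegrableOn H (Metric.closedBall y s)ᶜ) :
    IntegrableOn (fun r : ℝ => r ^ 2 * ∫ n : S2, H (y + r • (n : E3)) ∂dOmega) (Set.Ioi s) ∧
    ∫ x in (Metric.closedBall y s)ᶜ, H x =
      ∫ r in Set.Ioi s, r ^ 2 * ∫ n : S2, H (y + r • (n : E3)) ∂dOmega ∧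
    ∀ᵐ r ∂(volume.restrict (Set.Ioi s)),
      Integrable (fun n : S2 => H (y + r • (n : E3))) dOmega := by
  have hm : MeasurableSet (Metric.closedBall y s)ᶜ := Metric.isClosed_closedBall.measurableSet.compl
  set f : E3 → ℝ := fun z => (Metric.closedBall y s)ᶜ.indicator H (y + z) with hf
  have hfi : Integrable f := ((integrable_indicator_iff hm).2 hH).comp_add_left y
  have hfint : ∫ z, f z = ∫ x in (Metric.closedBall y s)ᶜ, H x := by
    rw [hf, integral_add_left_eq_self, integral_indicator hm]
  obtain ⟨h1, h2, h3⟩ := polar_slice f hfi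
  have ev : ∀ r : ℝ, s < r → ∀ n : S2, f (r • (n : E3)) = H (y + r • (n : E3)) := by
    intro r hr n
    have : y + r • (n : E3) ∈ (Metric.closedBall y s)ᶜ := by
      simp only [Set.mem_compl_iff, Metric.mem_closedBall, dist_eq_norm, add_sub_cancel_left]
      rw [norm_smulS r (hs.trans hr)]; linarith
    simp only [hf]
    rw [Set.indicator_of_mem this]
  have ev0 : ∀ r : ℝ, 0 < r → r ≤ s → ∀ n : S2, f (r • (n : E3)) = 0 := by
    intro r hr0 hr n
    have : y + r • (n : E3) ∉ (Metric.closedBall y s)ᶜ := by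
      simp only [Set.mem_compl_iff, Metric.mem_closedBall, dist_eq_norm, add_sub_cancel_left, not_not]
      rw [norm_smulS r hr0]; linarith
    simp only [hf]
    rw [Set.indicator_of_notMem this]
  have hsub : Set.Ioi s ⊆ Set.Ioi (0:ℝ) := Set.Ioi_subset_Ioi hs.le
  have hc : Set.EqOn (fun r : ℝ => r ^ 2 * ∫ n : S2, f (r • (n : E3)) ∂dOmega)
      (fun r : ℝ => r ^ 2 * ∫ n : S2, H (y + r • (n : E3)) ∂dOmega) (Set.Ioi s) := by
    intro r hr
    simp only
    simp_rw [ev r hr]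
  refine ⟨(h1.mono_set hsub).congr_fun hc measurableSet_Ioi, ?_, ?_⟩
  · rw [← hfint, h2, ← setIntegral_congr_fun measurableSet_Ioi hc]
    apply setIntegral_eq_of_subset_of_forall_sdiff_eq_zero measurableSet_Ioi hsub
    rintro r ⟨hr0, hr⟩
    simp_rw [ev0 r hr0 (not_lt.1 hr)]
    simp
  · have h4 := ae_restrict_of_ae_restrict_of_subset hsub h3
    filter_upwards [h4, ae_restrict_mem measurableSet_Ioi] with r hr hr2
    simp_rw [ev r hr2] at hr
    exact hr

lemma small_ball {f : E3 → ℝ} {y : E3} {δ : ℝ} (hδ : 0 < δ) (hf : IntegrableOn f (Metric.ball y δ)) :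
    Tendsto (fun s : ℝ => ∫ x in Metric.closedBall y s, f x) (𝓝[>] 0) (𝓝 0) := by
  have hm : Tendsto (volume.restrict (Metric.ball y δ) ∘ fun s : ℝ => Metric.closedBall y s) (𝓝[>] 0) (𝓝 0) := by
    have h1 : Tendsto (fun s : ℝ => volume (Metric.closedBall y s)) (𝓝[>] 0) (𝓝 0) := by
      have h2 : Tendsto (fun s : ℝ => ENNReal.ofReal (s ^ Module.finrank ℝ E3) * volume (Metric.ball (0 : E3) 1))
          (𝓝[>] 0) (𝓝 (ENNReal.ofReal (0 ^ Module.finrank ℝ E3) * volume (Metric.ball (0 : E3) 1))) := by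
        apply ENNReal.Tendsto.mul_const _ (Or.inr measure_ball_lt_top.ne)
        apply ENNReal.tendsto_ofReal
        exact ((continuous_pow _).tendsto 0).mono_left nhdsWithin_le_nhds
      have h3 : ENNReal.ofReal ((0:ℝ) ^ Module.finrank ℝ E3) * volume (Metric.ball (0 : E3) 1) = 0 := by
        simp
      rw [h3] at h2
      refine h2.congr' ?_
      filter_upwards [self_mem_nhdsWithin] with s hs
      rw [Measure.addHaar_closedBall _ _ (le_of_lt hs)]
    exact tendsto_of_tendsto_of_tendsto_of_le_of_le tendsto_const_nhds h1 (fun _ => zero_le)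
      (fun s => Measure.restrict_apply_le _ _)
  have := (Integrable.tendsto_setIntegral_nhds_zero hf hm)
  refine this.congr' ?_
  filter_upwards [Ioo_mem_nhdsGT hδ] with s hs
  rw [Measure.restrict_restrict Metric.isClosed_closedBall.measurableSet,
    Set.inter_eq_self_of_subset_left (Metric.closedBall_subset_ball hs.2)]

theorem core
    (y₁ y₂ : E3) (hy : y₁ ≠ y₂) (s₁ s₂ : ℝ) (hs₂ : 0 < s₂)
    (F : E3 → ℝ) (c d : ℝ → S2 → ℝ) (hF : MemF y₁ y₂ F c d)
    (η : ℝ) (hη : 0 < η)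
    (hdecay : ∃ C R : ℝ, ∀ x : E3, R ≤ ‖x‖ → |F x| ≤ C * ‖x‖ ^ (-3 - η))
    (L : ℝ) (hL : HasPfIntegral y₁ y₂ s₁ s₂ F c d L)
    (Ft : E3 → ℝ)
    (hFt : ∀ x : E3, Ft x
      = F x - ∑ᶠ (b : ℝ) (_ : b ≤ -3), ‖x - y₂‖ ^ b * d b (dir y₂ x))
    (A : ℝ → ℝ)
    (hA : ∀ r : ℝ, A r = (4 * π)⁻¹ * ∫ n : S2, Ft (y₁ + r • (n : E3)) ∂dOmega) :
    IntegrableOn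
        (fun r : ℝ => r ^ 2 * A r + (1 / r) * ((4 * π)⁻¹ * ∫ n : S2, d (-3) n ∂dOmega))
        (Set.Ioi ‖y₁ - y₂‖) volume
    ∧ Tendsto
          (fun s : ℝ =>
            4 * π * (∫ r in s..‖y₁ - y₂‖, r ^ 2 * A r)
              + (∑ᶠ (a : ℝ) (_ : a < -3), s ^ (a + 3) / (a + 3) * ∫ n : S2, c a n ∂dOmega)
              + Real.log (s / s₁) * ∫ n : S2, c (-3) n ∂dOmega)
          (𝓝[>] (0 : ℝ)) (𝓝 (L - (4 * π * (∫ r in Set.Ioi ‖y₁ - y₂‖,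
                (r ^ 2 * A r + (1 / r) * ((4 * π)⁻¹ * ∫ n : S2, d (-3) n ∂dOmega)))
            + (∫ n : S2, d (-3) n ∂dOmega) * Real.log (‖y₁ - y₂‖ / s₂)))) := by
  have hd := hF.exp₂
  have hπ : 4 * π ≠ 0 := by positivity
  obtain ⟨T, T2, hT, hT2, hs⟩ := sum_split d hd.finite_exponents
  set ρ := ‖y₁ - y₂‖ with hρdef
  have hρ : 0 < ρ := norm_pos_iff.2 (sub_ne_zero.2 hy)
  set g := d (-3) with hgdef
  have hg : SmoothSphereFn g := hd.smooth_coeffs _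
  set I3 := ∫ n : S2, g n ∂dOmega with hI3
  obtain ⟨B, hB0, hB⟩ := hg.bdd
  let Gs : E3 → ℝ := fun x => ∑ b ∈ T, ‖x - y₂‖ ^ b * d b (dir y₂ x)
  let G : E3 → ℝ := fun x => Gs x + ‖x - y₂‖ ^ (-3 : ℝ) * g (dir y₂ x)
  have hFt' : ∀ x, Ft x = F x - G x := by
    intro x
    rw [hFt, (hs _ (by intro b hb; simp [hb])).2.1]
  obtain ⟨δ, hδ, hFtδ⟩ := Ft_int hF.smooth hd hT2 (fun t ht => (hs t ht).2.2) hFt'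
  let H : E3 → ℝ := fun x => Ft x + tail g ρ (x - y₁)
  let K : ℝ → E3 → ℝ := fun s x => (Metric.closedBall y₂ s)ᶜ.indicator Gs x +
    (tail g s (x - y₂) - tail g ρ (x - y₁))
  have mB : ∀ (y : E3) (s : ℝ), MeasurableSet (Metric.closedBall y s) :=
    fun y s => Metric.isClosed_closedBall.measurableSet
  have hGsi : ∀ s, 0 < s → IntegrableOn Gs (Metric.closedBall y₂ s)ᶜ := fun s hs0 =>
    integrable_finsetSum _ fun b hb =>
      (radial_ext y₂ b (hT b hb) (d b) (hd.smooth_coeffs b).integ s hs0).1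
  have hGsint : ∀ s, 0 < s → ∫ x in (Metric.closedBall y₂ s)ᶜ, Gs x =
      - ∑ b ∈ T, s ^ (b + 3) / (b + 3) * ∫ n, d b n ∂dOmega := by
    intro s hs0
    simp only [Gs]
    rw [integral_finsetSum, ← Finset.sum_neg_distrib]
    · exact Finset.sum_congr rfl fun b hb =>
        (radial_ext y₂ b (hT b hb) (d b) (hd.smooth_coeffs b).integ s hs0).2
    · intro b hb
      exact (radial_ext y₂ b (hT b hb) (d b) (hd.smooth_coeffs b).integ s hs0).1
  have hKi : ∀ s, 0 < s → s ≤ ρ → Integrable (K s) := fun s hs0 hsρ =>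
    ((integrable_indicator_iff (mB _ _).compl).2 (hGsi s hs0)).add (tail_compare hg hs0 hsρ y₁ y₂).1
  have hKint : ∀ s, 0 < s → s ≤ ρ → ∫ x, K s x =
      - ∑ b ∈ T, s ^ (b + 3) / (b + 3) * (∫ n, d b n ∂dOmega) + log (ρ / s) * I3 := by
    intro s hs0 hsρ
    simp only [K]
    rw [integral_add ((integrable_indicator_iff (mB _ _).compl).2 (hGsi s hs0))
      (tail_compare hg hs0 hsρ y₁ y₂).1, integral_indicator (mB _ _).compl, hGsint s hs0,
      (tail_compare hg hs0 hsρ y₁ y₂).2]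
  have hGK : ∀ s x, x ∉ Metric.closedBall y₂ s → G x = K s x + tail g ρ (x - y₁) := by
    intro s x hx
    have h1 : s < ‖x - y₂‖ := by simpa [dist_eq_norm] using hx
    simp only [G, K, Set.indicator_of_mem (show x ∈ (Metric.closedBall y₂ s)ᶜ from hx)]
    have : tail g s (x - y₂) = ‖x - y₂‖ ^ (-3 : ℝ) * g (dir y₂ x) := by
      rw [tail, Set.indicator_of_mem (by exact h1), dir_sub y₂]
    rw [this]; ring
  have htb : ∀ (y : E3) (r : ℝ), IntegrableOn (fun x => tail g ρ (x - y₁)) (Metric.ball y r) := by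
    intro y r
    apply Measure.integrableOn_of_bounded (M := B * ρ ^ (-3 : ℝ)) measure_ball_lt_top.ne
    · exact ((tail_meas hg ρ).comp (by fun_prop)).aestronglyMeasurable
    · exact ae_of_all _ fun x => tail_le hB0 hB hρ _
  have hGi : IntegrableOn G (Metric.ball y₁ (ρ / 2)) := by
    have h1 : IntegrableOn (fun x => K (ρ / 2) x + tail g ρ (x - y₁)) (Metric.ball y₁ (ρ / 2)) :=
      (hKi (ρ / 2) (by linarith) (by linarith)).integrableOn.add (htb _ _)
    refine h1.congr_fun ?_ measurableSet_ball
    intro x hx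
    refine (hGK (ρ / 2) x ?_).symm
    intro hx2
    rw [Metric.mem_ball] at hx
    rw [Metric.mem_closedBall] at hx2
    have : ρ ≤ dist x y₁ + dist x y₂ := by
      rw [hρdef, ← dist_eq_norm]; exact dist_triangle_left _ _ _
    linarith
  set σ := min δ (ρ / 2) with hσ
  have hσ0 : 0 < σ := lt_min hδ (by linarith)
  have hHi : ∀ s, 0 < s → s < σ → IntegrableOn H (Metric.closedBall y₁ s)ᶜ := by
    intro s hs0 hsσ
    have hsδ : s < δ := hsσ.trans_le (min_le_left _ _)
    have hsρ : s < ρ / 2 := hsσ.trans_le (min_le_right _ _)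
    have h1 : IntegrableOn H (Metric.closedBall y₁ s ∪ Metric.closedBall y₂ s)ᶜ := by
      have h2 := (F_int hF.smooth hη hdecay hs0).sub (hKi s hs0 (by linarith)).integrableOn
      refine h2.congr_fun ?_ ((mB _ _).union (mB _ _)).compl
      intro x hx
      simp only [Pi.sub_apply, H]
      rw [hFt', hGK s x (fun h => hx (Or.inr h))]; ring
    have h2 : IntegrableOn H (Metric.ball y₂ δ) := hFtδ.add (htb _ _)
    refine (h1.union h2).mono_set ?_
    intro x hx
    by_cases hx2 : x ∈ Metric.closedBall y₂ s
    · right; exact Metric.closedBall_subset_ball hsδ hx2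
    · left; rintro (h | h)
      · exact hx h
      · exact hx2 h
  have hsl1 : ∀ r, 0 < r → r ≤ ρ →
      r ^ 2 * ∫ n : S2, H (y₁ + r • (n : E3)) ∂dOmega = 4 * π * (r ^ 2 * A r) := by
    intro r hr hrρ
    have : ∀ n : S2, H (y₁ + r • (n : E3)) = Ft (y₁ + r • (n : E3)) := by
      intro n
      simp only [H]
      rw [add_sub_cancel_left, tail, Set.indicator_of_notMem, add_zero]
      simp only [Set.mem_ofPred_eq, norm_smulS r hr]; linarith
    simp_rw [this]
    rw [hA]; field_simp
  have hsl2 : ∀ r, ρ < r → Integrable (fun n : S2 => H (y₁ + r • (n : E3))) dOmega →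
      r ^ 2 * ∫ n : S2, H (y₁ + r • (n : E3)) ∂dOmega =
        4 * π * (r ^ 2 * A r + (1 / r) * ((4 * π)⁻¹ * I3)) := by
    intro r hr hi
    have hr0 : 0 < r := hρ.trans hr
    have e : ∀ n : S2, Ft (y₁ + r • (n : E3)) = H (y₁ + r • (n : E3)) - r ^ (-3 : ℝ) * g n := by
      intro n
      simp only [H]
      rw [add_sub_cancel_left, tail, Set.indicator_of_mem, norm_smulS r hr0, dir_smul0 r hr0]
      · ring
      · simp only [Set.mem_ofPred_eq, norm_smulS r hr0]; linarith
    have e3 : r ^ (-3 : ℝ) = (r ^ 3)⁻¹ := by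
      rw [rpow_neg hr0.le]; norm_num
    rw [hA]
    simp_rw [e]
    rw [integral_sub hi (hg.integ.const_mul _), integral_const_mul, e3]
    field_simp
    ring
  have hmain : ∀ s, 0 < s → s < σ →
      IntegrableOn (fun r : ℝ => r ^ 2 * A r + (1 / r) * ((4 * π)⁻¹ * I3)) (Set.Ioi ρ) ∧
      ∫ x in (Metric.closedBall y₁ s)ᶜ, H x = 4 * π * (∫ r in s..ρ, r ^ 2 * A r) +
        4 * π * (∫ r in Set.Ioi ρ, (r ^ 2 * A r + (1 / r) * ((4 * π)⁻¹ * I3))) := by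
    intro s hs0 hsσ
    have hsρ : s < ρ / 2 := hsσ.trans_le (min_le_right _ _)
    have hsρ' : s ≤ ρ := by linarith
    obtain ⟨h1, h2, h3⟩ := slice_ext H y₁ s hs0 (hHi s hs0 hsσ)
    have hsub : Set.Ioi ρ ⊆ Set.Ioi s := Set.Ioi_subset_Ioi hsρ'
    have hae : (fun r : ℝ => r ^ 2 * ∫ n : S2, H (y₁ + r • (n : E3)) ∂dOmega)
        =ᵐ[volume.restrict (Set.Ioi ρ)]
        (fun r => 4 * π * (r ^ 2 * A r + (1 / r) * ((4 * π)⁻¹ * I3))) := by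
      filter_upwards [ae_restrict_of_ae_restrict_of_subset hsub h3,
        ae_restrict_mem measurableSet_Ioi] with r hr hr2
      exact hsl2 r hr2 hr
    constructor
    · have := (h1.mono_set hsub).congr hae
      have h4 := this.const_mul (4 * π)⁻¹
      refine h4.congr (ae_of_all _ fun r => ?_)
      simp only
      rw [← mul_assoc, inv_mul_cancel₀ hπ, one_mul]
    · rw [h2, ← Set.Ioc_union_Ioi_eq_Ioi hsρ', setIntegral_union Set.Ioc_disjoint_Ioi_same
        measurableSet_Ioi (h1.mono_set Set.Ioc_subset_Ioi_self) (h1.mono_set hsub),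
        integral_congr_ae hae, integral_const_mul, intervalIntegral.integral_of_le hsρ']
      congr 1
      rw [← integral_const_mul]
      exact setIntegral_congr_fun measurableSet_Ioc fun r hr => hsl1 r (hs0.trans hr.1) hr.2
  refine ⟨(hmain (σ / 2) (by linarith) (by linarith)).1, ?_⟩
  set J := ∫ r in Set.Ioi ρ, (r ^ 2 * A r + (1 / r) * ((4 * π)⁻¹ * I3)) with hJ
  have hdec : ∀ s, 0 < s → s < σ → ∫ x in (Metric.closedBall y₁ s ∪ Metric.closedBall y₂ s)ᶜ, F x =
      (∫ x in (Metric.closedBall y₁ s)ᶜ, H x) + (∫ x, K s x)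
        - (∫ x in Metric.closedBall y₂ s, Ft x) - ∫ x in Metric.closedBall y₁ s, G x := by
    intro s hs0 hsσ
    have hsδ : s < δ := hsσ.trans_le (min_le_left _ _)
    have hsρ : s < ρ / 2 := hsσ.trans_le (min_le_right _ _)
    have i1 := (integrable_indicator_iff (mB y₁ s).compl).2 (hHi s hs0 hsσ)
    have i2 := hKi s hs0 (by linarith)
    have i3 := (integrable_indicator_iff (mB y₂ s)).2
      (hFtδ.mono_set (Metric.closedBall_subset_ball hsδ))
    have i4 := (integrable_indicator_iff (mB y₁ s)).2
      (hGi.mono_set (Metric.closedBall_subset_ball hsρ))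
    have i12 := i1.add i2
    have i123 := i12.sub i3
    rw [← integral_indicator ((mB _ _).union (mB _ _)).compl, ← integral_indicator (mB y₁ s).compl,
      ← integral_indicator (mB y₁ s), ← integral_indicator (mB y₂ s), ← integral_add i1 i2,
      ← integral_sub (by exact i12) i3, ← integral_sub (by exact i123) i4]
    congr 1
    funext x
    have htri : ρ ≤ dist x y₁ + dist x y₂ := by
      rw [hρdef, ← dist_eq_norm]; exact dist_triangle_left _ _ _
    by_cases h1 : x ∈ Metric.closedBall y₁ s
    · have h1' := Metric.mem_closedBall.1 h1
      have h2 : x ∉ Metric.closedBall y₂ s := by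
        intro h; have := Metric.mem_closedBall.1 h; linarith
      have ht : tail g ρ (x - y₁) = 0 := by
        rw [tail, Set.indicator_of_notMem]
        simp only [Set.mem_ofPred_eq, ← dist_eq_norm]; linarith
      have := hGK s x h2
      simp [h1, h2, this, ht]
    · by_cases h2 : x ∈ Metric.closedBall y₂ s
      · have h2' := Metric.mem_closedBall.1 h2
        have ht : tail g s (x - y₂) = 0 := by
          rw [tail, Set.indicator_of_notMem]
          simp only [Set.mem_ofPred_eq, ← dist_eq_norm]; linarith
        simp only [h1, h2, Set.mem_compl_iff, Set.mem_union, or_true, not_true_eq_false,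
          not_false_eq_true, Set.indicator_of_notMem, Set.indicator_of_mem, H, K, ht]
        ring
      · have hG := hGK s x h2
        simp only [h1, h2, Set.mem_compl_iff, Set.mem_union, or_self,
          not_false_eq_true, Set.indicator_of_notMem, Set.indicator_of_mem, H]
        rw [hFt', hG]; ring
  have hlim := (hL.add ((small_ball hδ hFtδ).add (small_ball (by linarith : 0 < ρ / 2) hGi))).sub_const
    (4 * π * J + I3 * Real.log (ρ / s₂))
  rw [add_zero, add_zero] at hlim
  refine hlim.congr' ?_
  filter_upwards [Ioo_mem_nhdsGT hσ0] with s hs1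
  obtain ⟨hs0, hsσ⟩ := hs1
  have hsρ : s < ρ / 2 := hsσ.trans_le (min_le_right _ _)
  rw [pfApprox, hdec s hs0 hsσ, (hmain s hs0 hsσ).2, hKint s hs0 (by linarith),
    (hs (fun b => s ^ (b + 3) / (b + 3) * ∫ n : S2, d b n ∂dOmega) (by intro b hb; simp [hb])).1,
    log_div hρ.ne' hs0.ne', log_div hs0.ne' hs₂.ne', log_div hρ.ne' hs₂.ne']
  ring

/-- partie finie by angular then radial integration.  With
`F̃₂ = F − Σ_{b ≤ −3} r₂^b g_b(n₂)` and `Ã(r)` its angular average on the sphere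
of radius `r` around `y₁`, the radial function is integrable on `(r₁₂, ∞)` after
the compensating `(r₂³F)₂/r` is added, the radial partie finie on `(0, r₁₂)`
exists, and `Pf ∫ F = 4π Pf∫₀^{r₁₂} r²Ã dr + 4π ∫_{r₁₂}^∞ (r²Ã + (r₂³F)₂/r) dr
+ 4π (r₂³F)₂ ln(r₁₂/s₂)`. -/
theorem pf_by_angular_then_radial_integration
    (y₁ y₂ : E3) (hy : y₁ ≠ y₂) (s₁ s₂ : ℝ) (hs₁ : 0 < s₁) (hs₂ : 0 < s₂)
    (F : E3 → ℝ) (c d : ℝ → S2 → ℝ) (hF : MemF y₁ y₂ F c d)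
    (hci : IntegerExponents c) (hdi : IntegerExponents d)
    (η : ℝ) (hη : 0 < η)
    (hdecay : ∃ C R : ℝ, ∀ x : E3, R ≤ ‖x‖ → |F x| ≤ C * ‖x‖ ^ (-3 - η))
    (L : ℝ) (hL : HasPfIntegral y₁ y₂ s₁ s₂ F c d L)
    -- the regularized function F̃₂ and its angular average Ã
    (Ft : E3 → ℝ)
    (hFt : ∀ x : E3, Ft x
      = F x - ∑ᶠ (b : ℝ) (_ : b ≤ -3), ‖x - y₂‖ ^ b * d b (dir y₂ x))
    (A : ℝ → ℝ)
    (hA : ∀ r : ℝ, A r = (4 * π)⁻¹ * ∫ n : S2, Ft (y₁ + r • (n : E3)) ∂dOmega) :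
    IntegrableOn
        (fun r : ℝ => r ^ 2 * A r + (1 / r) * ((4 * π)⁻¹ * ∫ n : S2, d (-3) n ∂dOmega))
        (Set.Ioi ‖y₁ - y₂‖) volume
    ∧ ∃ Lrad : ℝ,
        Tendsto
          (fun s : ℝ =>
            (∫ r in s..‖y₁ - y₂‖, r ^ 2 * A r)
              + (∑ᶠ (a : ℝ) (_ : a < -3),
                  s ^ (a + 3) / (a + 3) * ((4 * π)⁻¹ * ∫ n : S2, c a n ∂dOmega))
              + Real.log (s / s₁) * ((4 * π)⁻¹ * ∫ n : S2, c (-3) n ∂dOmega))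
          (𝓝[>] (0 : ℝ)) (𝓝 Lrad)
        ∧ L = 4 * π * Lrad
            + 4 * π * (∫ r in Set.Ioi ‖y₁ - y₂‖,
                (r ^ 2 * A r + (1 / r) * ((4 * π)⁻¹ * ∫ n : S2, d (-3) n ∂dOmega)))
            + 4 * π * ((4 * π)⁻¹ * ∫ n : S2, d (-3) n ∂dOmega)
                * Real.log (‖y₁ - y₂‖ / s₂) := by
  obtain ⟨h1, h2⟩ := core y₁ y₂ hy s₁ s₂ hs₂ F c d hF η hη hdecay L hL Ft hFt A hA
  refine ⟨h1, _, (h2.const_mul (4 * π)⁻¹).congr fun s => ?_, ?_⟩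
  · obtain ⟨T, T2, -, -, hs⟩ := sum_split c hF.exp₁.finite_exponents
    rw [(hs (fun a => s ^ (a + 3) / (a + 3) * ∫ n : S2, c a n ∂dOmega)
        (by intro b hb; simp [hb])).1,
      (hs (fun a => s ^ (a + 3) / (a + 3) * ((4 * π)⁻¹ * ∫ n : S2, c a n ∂dOmega))
        (by intro b hb; simp [hb])).1, mul_add, mul_add, Finset.mul_sum]
    have hπ : 4 * π ≠ 0 := by positivity
    congr 1
    · congr 1
      · rw [← mul_assoc, inv_mul_cancel₀ hπ, one_mul]
      · exact Finset.sum_congr rfl fun b _ => by ring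
    · ring
  · have hπ : 4 * π ≠ 0 := by positivity
    rw [← mul_assoc (4 * π) (4 * π)⁻¹, mul_inv_cancel₀ hπ, one_mul,
      ← mul_assoc (4 * π) (4 * π)⁻¹, mul_inv_cancel₀ hπ, one_mul]
    ring

end
end
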